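/- arXiv:1602.04731 — 2 statements merged into one kernel-verified Lean document; each statement's English description precedes it below -/
import Mathlib

section
/- Let ζ be an extremal number. Then there exist constants c > 0 and c' > 0 and a strictly increasing sequence (x_k)_{k≥1} of positive integers such that x_{k+1} ≤ c·x_k^{(1+√5)/2} and max_{1≤j≤4} ‖x_k ζ^j‖ ≤ c'·x_k^{−(√5−1)/4} for all k ≥ 1, where ‖·‖ denotes the distance to the nearest integer. -/
open Polynomial

/-- Height of an integer polynomial: the maximum absolute value of its coefficients. -/
noncomputable def polyH (P : Polynomial ℤ) : ℝ :=
  (((P.support.sup fun i => (P.coeff i).natAbs) : ℕ) : ℝ)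

/-- Evaluation of an integer polynomial at a real number. -/
noncomputable def pev (ζ : ℝ) (P : Polynomial ℤ) : ℝ := Polynomial.aeval ζ P

/-- Set of exponents η such that for arbitrarily large X the system
    H(P) ≤ X, 0 < |P(ζ)| ≤ X^(−η) has a solution of degree at most n. -/
def wSet (n : ℕ) (ζ : ℝ) : Set ℝ :=
  {η | ∀ X₀ : ℝ, ∃ X : ℝ, X₀ ≤ X ∧ ∃ P : Polynomial ℤ,
    P.natDegree ≤ n ∧ polyH P ≤ X ∧ 0 < |pev ζ P| ∧ |pev ζ P| ≤ X ^ (-η)}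

/-- The exponent w_n(ζ). -/
noncomputable def wExp (n : ℕ) (ζ : ℝ) : ℝ := sSup (wSet n ζ)

/-- Set of exponents η such that for all sufficiently large X the system
    H(P) ≤ X, 0 < |P(ζ)| ≤ X^(−η) has a solution of degree at most n. -/
def whSet (n : ℕ) (ζ : ℝ) : Set ℝ :=
  {η | ∃ X₀ : ℝ, ∀ X : ℝ, X₀ ≤ X → ∃ P : Polynomial ℤ,
    P.natDegree ≤ n ∧ polyH P ≤ X ∧ 0 < |pev ζ P| ∧ |pev ζ P| ≤ X ^ (-η)}

/-- The uniform exponent ŵ_n(ζ). -/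
noncomputable def whExp (n : ℕ) (ζ : ℝ) : ℝ := sSup (whSet n ζ)

/-- Set of exponents η such that for arbitrarily large X the system
    |x| ≤ X, max_{1≤i≤n} |ζ^i x − y_i| ≤ X^(−η) has a nonzero integer solution. -/
def lamSet (n : ℕ) (ζ : ℝ) : Set ℝ :=
  {η | ∀ X₀ : ℝ, ∃ X : ℝ, X₀ ≤ X ∧ ∃ x : ℤ, ∃ y : Fin n → ℤ,
    (x ≠ 0 ∨ y ≠ 0) ∧ ((|x| : ℤ) : ℝ) ≤ X ∧
    ∀ i : Fin n, |ζ ^ ((i : ℕ) + 1) * (x : ℝ) - (y i : ℝ)| ≤ X ^ (-η)}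

/-- The exponent λ_n(ζ). -/
noncomputable def lamExp (n : ℕ) (ζ : ℝ) : ℝ := sSup (lamSet n ζ)

/-- Set of exponents η such that for all sufficiently large X the system
    |x| ≤ X, max_{1≤i≤n} |ζ^i x − y_i| ≤ X^(−η) has a nonzero integer solution. -/
def lamhSet (n : ℕ) (ζ : ℝ) : Set ℝ :=
  {η | ∃ X₀ : ℝ, ∀ X : ℝ, X₀ ≤ X → ∃ x : ℤ, ∃ y : Fin n → ℤ,
    (x ≠ 0 ∨ y ≠ 0) ∧ ((|x| : ℤ) : ℝ) ≤ X ∧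
    ∀ i : Fin n, |ζ ^ ((i : ℕ) + 1) * (x : ℝ) - (y i : ℝ)| ≤ X ^ (-η)}

/-- The uniform exponent λ̂_n(ζ). -/
noncomputable def lamhExp (n : ℕ) (ζ : ℝ) : ℝ := sSup (lamhSet n ζ)

/-- Set of exponents η such that for arbitrarily large X the polynomial system has
    at least j linearly independent solutions of degree at most n. -/
def wSetJ (n j : ℕ) (ζ : ℝ) : Set ℝ :=
  {η | ∀ X₀ : ℝ, ∃ X : ℝ, X₀ ≤ X ∧ ∃ P : Fin j → Polynomial ℤ,
    LinearIndependent ℤ P ∧ ∀ i : Fin j,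
      (P i).natDegree ≤ n ∧ polyH (P i) ≤ X ∧ 0 < |pev ζ (P i)| ∧ |pev ζ (P i)| ≤ X ^ (-η)}

/-- The exponent w_{n,j}(ζ). -/
noncomputable def wExpJ (n j : ℕ) (ζ : ℝ) : ℝ := sSup (wSetJ n j ζ)

/-- Set of exponents η such that for all sufficiently large X the polynomial system has
    at least j linearly independent solutions of degree at most n. -/
def whSetJ (n j : ℕ) (ζ : ℝ) : Set ℝ :=
  {η | ∃ X₀ : ℝ, ∀ X : ℝ, X₀ ≤ X → ∃ P : Fin j → Polynomial ℤ,
    LinearIndependent ℤ P ∧ ∀ i : Fin j,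
      (P i).natDegree ≤ n ∧ polyH (P i) ≤ X ∧ 0 < |pev ζ (P i)| ∧ |pev ζ (P i)| ≤ X ^ (-η)}

/-- The uniform exponent ŵ_{n,j}(ζ). -/
noncomputable def whExpJ (n j : ℕ) (ζ : ℝ) : ℝ := sSup (whSetJ n j ζ)

/-- Set of exponents η such that for arbitrarily large X the simultaneous approximation
    system has at least j linearly independent integer vector solutions. -/
def lamSetJ (n j : ℕ) (ζ : ℝ) : Set ℝ :=
  {η | ∀ X₀ : ℝ, ∃ X : ℝ, X₀ ≤ X ∧ ∃ v : Fin j → (Fin (n + 1) → ℤ),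
    LinearIndependent ℤ v ∧ ∀ i : Fin j,
      ((|v i 0| : ℤ) : ℝ) ≤ X ∧
      ∀ t : Fin n, |ζ ^ ((t : ℕ) + 1) * ((v i 0 : ℤ) : ℝ) - ((v i t.succ : ℤ) : ℝ)| ≤ X ^ (-η)}

/-- The exponent λ_{n,j}(ζ). -/
noncomputable def lamExpJ (n j : ℕ) (ζ : ℝ) : ℝ := sSup (lamSetJ n j ζ)

/-- Set of exponents η such that for all sufficiently large X the simultaneous approximation
    system has at least j linearly independent integer vector solutions. -/
def lamhSetJ (n j : ℕ) (ζ : ℝ) : Set ℝ :=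
  {η | ∃ X₀ : ℝ, ∀ X : ℝ, X₀ ≤ X → ∃ v : Fin j → (Fin (n + 1) → ℤ),
    LinearIndependent ℤ v ∧ ∀ i : Fin j,
      ((|v i 0| : ℤ) : ℝ) ≤ X ∧
      ∀ t : Fin n, |ζ ^ ((t : ℕ) + 1) * ((v i 0 : ℤ) : ℝ) - ((v i t.succ : ℤ) : ℝ)| ≤ X ^ (-η)}

/-- The uniform exponent λ̂_{n,j}(ζ). -/
noncomputable def lamhExpJ (n j : ℕ) (ζ : ℝ) : ℝ := sSup (lamhSetJ n j ζ)

/-- An extremal number: a real transcendental number with ŵ₂(ζ) = (3+√5)/2. -/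
def IsExtremal (ζ : ℝ) : Prop :=
  Transcendental ℚ ζ ∧ whExp 2 ζ = (3 + Real.sqrt 5) / 2

/-- Value at `ζ` of the quadratic polynomial with coefficients `v`, constant term first. -/
def quadEval (ζ : ℝ) (v : ℤ × ℤ × ℤ) : ℝ := v.1 + v.2.1 * ζ + v.2.2 * ζ ^ 2

/-- The maximum of the absolute values of the coordinates of `v`. -/
def quadHeight (v : ℤ × ℤ × ℤ) : ℕ := max v.1.natAbs (max v.2.1.natAbs v.2.2.natAbs)

lemma abs_snd_le_quadHeight (v : ℤ × ℤ × ℤ) : |(v.2.1 : ℝ)| ≤ quadHeight v := by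
  rw [← Int.cast_abs, Int.abs_eq_natAbs]
  exact_mod_cast (le_max_left _ _).trans (le_max_right _ _)

lemma abs_thd_le_quadHeight (v : ℤ × ℤ × ℤ) : |(v.2.2 : ℝ)| ≤ quadHeight v := by
  rw [← Int.cast_abs, Int.abs_eq_natAbs]
  exact_mod_cast (le_max_right _ _).trans (le_max_right _ _)

lemma quadHeight_eq_zero {v : ℤ × ℤ × ℤ} : quadHeight v = 0 ↔ v = 0 := by
  obtain ⟨a, b, c⟩ := v
  simp only [quadHeight, Prod.mk_eq_zero]
  omega

lemma finite_quadHeight_le (n : ℕ) : {v : ℤ × ℤ × ℤ | quadHeight v ≤ n}.Finite := by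
  refine (Set.finite_Icc ((-n, -n, -n) : ℤ × ℤ × ℤ) (n, n, n)).subset ?_
  rintro ⟨a, b, c⟩ hv
  simp only [quadHeight, Set.mem_ofPred_eq] at hv
  simp only [Set.mem_Icc, Prod.mk_le_mk]
  omega

lemma quadEval_ne_zero {ζ : ℝ} (hζ : Transcendental ℚ ζ) {v : ℤ × ℤ × ℤ} (hv : v ≠ 0) :
    quadEval ζ v ≠ 0 := by
  obtain ⟨a, b, c⟩ := v
  intro h
  have hζ' : Transcendental ℤ ζ := fun h' => hζ (h'.extendScalars Int.cast_injective)
  have h0 := transcendental_iff.mp hζ' (C a + C b * X + C c * X ^ 2)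
    (by simpa [quadEval] using h)
  have h1 := congrArg (fun p => p.coeff 0) h0
  have h2 := congrArg (fun p => p.coeff 1) h0
  have h3 := congrArg (fun p => p.coeff 2) h0
  simp [coeff_X, coeff_X_pow] at h1 h2 h3
  subst h1
  simp at h2
  subst h2
  simp at h3
  exact hv (by simp [h3])

lemma exists_quadEval_le_of_isExtremal {ζ : ℝ} (hζ : IsExtremal ζ) :
    ∃ X₀ : ℝ, ∀ X : ℝ, X₀ ≤ X → ∃ v : ℤ × ℤ × ℤ, (quadHeight v : ℝ) ≤ X ∧
      0 < |quadEval ζ v| ∧ |quadEval ζ v| ≤ X ^ (-(26178 / 10000 : ℝ)) := by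
  obtain ⟨-, h⟩ := hζ
  have h5 : (2.2361 : ℝ) > Real.sqrt 5 := by
    rw [gt_iff_lt, Real.sqrt_lt' (by norm_num)]; norm_num
  have h5' : (2.236 : ℝ) < Real.sqrt 5 := by
    rw [Real.lt_sqrt (by norm_num)]; norm_num
  have hne : (whSet 2 ζ).Nonempty := by
    by_contra hne
    rw [Set.not_nonempty_iff_eq_empty] at hne
    rw [whExp, hne, Real.sSup_empty] at h
    linarith
  obtain ⟨η, ⟨X₀, hX₀⟩, hη⟩ := exists_lt_of_lt_csSup hne
    (show (26178 / 10000 : ℝ) < sSup (whSet 2 ζ) by change _ < whExp 2 ζ; rw [h]; linarith)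
  refine ⟨max X₀ 1, fun X hX => ?_⟩
  obtain ⟨P, hdeg, hH, hpos, hle⟩ := hX₀ X ((le_max_left _ _).trans hX)
  have hev : pev ζ P = quadEval ζ (P.coeff 0, P.coeff 1, P.coeff 2) := by
    rw [pev, aeval_eq_sum_range' (n := 3) (by omega)]
    simp [Finset.sum_range_succ, quadEval]
  have hcoeff : ∀ i, (P.coeff i).natAbs ≤ P.support.sup fun i => (P.coeff i).natAbs := by
    intro i
    by_cases hi : i ∈ P.support
    · exact Finset.le_sup (f := fun i => (P.coeff i).natAbs) hi
    · simp [notMem_support_iff.mp hi]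
  refine ⟨(P.coeff 0, P.coeff 1, P.coeff 2), le_trans ?_ hH, hev ▸ hpos, ?_⟩
  · rw [polyH, Nat.cast_le]
    exact max_le (hcoeff 0) (max_le (hcoeff 1) (hcoeff 2))
  · rw [← hev]
    exact hle.trans (Real.rpow_le_rpow_of_exponent_le ((le_max_right _ _).trans hX) (by linarith))

/-- A sequence of minimal points: successive integer vectors at which the record small value of
`|quadEval ζ|` is improved. -/
structure IsMinimalSeq (ζ : ℝ) (P : ℕ → ℤ × ℤ × ℤ) : Prop where
  ne_zero : ∀ i, P i ≠ 0
  height_lt : ∀ i, quadHeight (P i) < quadHeight (P (i + 1))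
  eval_lt : ∀ i, |quadEval ζ (P (i + 1))| < |quadEval ζ (P i)|
  eval_le : ∀ i v, v ≠ 0 → quadHeight v < quadHeight (P (i + 1)) →
    |quadEval ζ (P i)| ≤ |quadEval ζ v|

lemma exists_min_quadEval {ζ : ℝ} {n : ℕ} (h : ∃ v : ℤ × ℤ × ℤ, v ≠ 0 ∧ quadHeight v ≤ n) :
    ∃ v : ℤ × ℤ × ℤ, v ≠ 0 ∧ quadHeight v ≤ n ∧
      ∀ u : ℤ × ℤ × ℤ, u ≠ 0 → quadHeight u ≤ n → |quadEval ζ v| ≤ |quadEval ζ u| := by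
  obtain ⟨w, hw⟩ := h
  obtain ⟨v, ⟨hv0, hvn⟩, hv⟩ := Set.exists_min_image {v : ℤ × ℤ × ℤ | v ≠ 0 ∧ quadHeight v ≤ n}
    (fun v => |quadEval ζ v|) ((finite_quadHeight_le n).subset fun v hv => hv.2) ⟨w, hw⟩
  exact ⟨v, hv0, hvn, fun u hu hun => hv u ⟨hu, hun⟩⟩

lemma exists_isMinimalSeq {ζ : ℝ} (h : ∀ ε : ℝ, 0 < ε → ∃ v : ℤ × ℤ × ℤ, v ≠ 0 ∧
    |quadEval ζ v| < ε) (h0 : ∀ v : ℤ × ℤ × ℤ, v ≠ 0 → quadEval ζ v ≠ 0) :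
    ∃ P : ℕ → ℤ × ℤ × ℤ, IsMinimalSeq ζ P := by
  let S := {v : ℤ × ℤ × ℤ // v ≠ 0 ∧
    ∀ u : ℤ × ℤ × ℤ, u ≠ 0 → quadHeight u ≤ quadHeight v → |quadEval ζ v| ≤ |quadEval ζ u|}
  have step : ∀ v : S, ∃ w : S, quadHeight v.1 < quadHeight w.1 ∧
      |quadEval ζ w.1| < |quadEval ζ v.1| ∧
      ∀ u, u ≠ 0 → quadHeight u < quadHeight w.1 → |quadEval ζ v.1| ≤ |quadEval ζ u| := by
    classical
    rintro ⟨v, hv0, hv⟩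
    have hex : ∃ n : ℕ, ∃ u : ℤ × ℤ × ℤ, u ≠ 0 ∧ quadHeight u ≤ n ∧
        |quadEval ζ u| < |quadEval ζ v| := by
      obtain ⟨u, hu0, hu⟩ := h _ (abs_pos.mpr (h0 v hv0))
      exact ⟨_, u, hu0, le_rfl, hu⟩
    obtain ⟨u, hu0, hun, hu⟩ := Nat.find_spec hex
    obtain ⟨w, hw0, hwn, hw⟩ := exists_min_quadEval (ζ := ζ) ⟨u, hu0, hun⟩
    have hwv : |quadEval ζ w| < |quadEval ζ v| := (hw u hu0 hun).trans_lt hu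
    have hweq : quadHeight w = Nat.find hex :=
      le_antisymm hwn (Nat.find_min' hex ⟨w, hw0, le_rfl, hwv⟩)
    refine ⟨⟨w, hw0, fun u hu0 hu => hw u hu0 (hweq ▸ hu)⟩, ?_, hwv, fun u hu0 hu => ?_⟩
    · by_contra hlt
      exact absurd (hv w hw0 (not_lt.mp hlt)) (not_le.mpr hwv)
    · by_contra hlt
      exact Nat.find_min hex (hweq ▸ hu) ⟨u, hu0, le_rfl, not_le.mp hlt⟩
  obtain ⟨v, hv0, hv1, hv⟩ := exists_min_quadEval (ζ := ζ) (n := 1)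
    ⟨(1, 0, 0), by simp, by simp [quadHeight]⟩
  choose f hf using step
  let s : ℕ → S := fun n => f^[n] ⟨v, hv0, fun u hu0 hu => hv u hu0 (hu.trans hv1)⟩
  have hs : ∀ n, s (n + 1) = f (s n) := fun n => Function.iterate_succ_apply' f n _
  exact ⟨fun n => (s n).1, fun i => (s i).2.1, fun i => by rw [hs]; exact (hf _).1,
    fun i => by rw [hs]; exact (hf _).2.1,
    fun i u hu0 hu => (hf (s i)).2.2 u hu0 (by rw [← hs]; exact hu)⟩

/-- The cross product of two integer triples. -/
def tripleCross (v w : ℤ × ℤ × ℤ) : ℤ × ℤ × ℤ :=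
  (v.2.1 * w.2.2 - v.2.2 * w.2.1, v.2.2 * w.1 - v.1 * w.2.2, v.1 * w.2.1 - v.2.1 * w.1)

/-- The dot product of two integer triples. -/
def tripleDot (v w : ℤ × ℤ × ℤ) : ℤ := v.1 * w.1 + v.2.1 * w.2.1 + v.2.2 * w.2.2

lemma quadEval_add (ζ : ℝ) (v w : ℤ × ℤ × ℤ) :
    quadEval ζ (v + w) = quadEval ζ v + quadEval ζ w := by
  simp only [quadEval, Prod.fst_add, Prod.snd_add]; push_cast; ring

lemma quadEval_smul (ζ : ℝ) (r : ℤ) (v : ℤ × ℤ × ℤ) :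
    quadEval ζ (r • v) = r * quadEval ζ v := by
  simp only [quadEval, Prod.smul_fst, Prod.smul_snd, smul_eq_mul]; push_cast; ring

lemma quadHeight_smul (r : ℤ) (v : ℤ × ℤ × ℤ) :
    quadHeight (r • v) = r.natAbs * quadHeight v := by
  simp only [quadHeight, Prod.smul_fst, Prod.smul_snd, smul_eq_mul, Int.natAbs_mul,
    Nat.mul_max_mul_left]

lemma quadHeight_add_le (v w : ℤ × ℤ × ℤ) :
    quadHeight (v + w) ≤ quadHeight v + quadHeight w := by
  have key : ∀ a b : ℤ, a.natAbs ≤ quadHeight v → b.natAbs ≤ quadHeight w →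
      (a + b).natAbs ≤ quadHeight v + quadHeight w := fun a b ha hb =>
    (Int.natAbs_add_le a b).trans (add_le_add ha hb)
  exact max_le (key _ _ (le_max_left _ _) (le_max_left _ _)) (max_le
    (key _ _ ((le_max_left _ _).trans (le_max_right _ _))
      ((le_max_left _ _).trans (le_max_right _ _)))
    (key _ _ ((le_max_right _ _).trans (le_max_right _ _))
      ((le_max_right _ _).trans (le_max_right _ _))))

lemma exists_two_mul_natAbs_sub_mul_le (a : ℤ) {r : ℤ} (hr : r ≠ 0) :
    ∃ b : ℤ, 2 * (a - r * b).natAbs ≤ r.natAbs := by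
  have h1 := Int.emod_nonneg a hr
  have h2 := Int.emod_lt_abs a hr
  have h3 := Int.emod_add_mul_ediv a r
  by_cases h : 2 * (a % r) ≤ |r|
  · refine ⟨a / r, ?_⟩
    have : a - r * (a / r) = a % r := by linarith
    rw [this]
    rw [Int.abs_eq_natAbs] at *
    generalize a % r = k at *
    omega
  · refine ⟨a / r + r.sign, ?_⟩
    have h4 : r * r.sign = |r| := Int.mul_sign_self r |>.trans (Int.abs_eq_natAbs r).symm
    have : a - r * (a / r + r.sign) = a % r - |r| := by rw [mul_add, h4]; linarith
    rw [this]
    rw [Int.abs_eq_natAbs] at *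
    generalize a % r = k at *
    omega

namespace IsMinimalSeq

variable {ζ : ℝ} {P : ℕ → ℤ × ℤ × ℤ}

lemma eq_zero_of_smul_add_smul_eq_zero (hP : IsMinimalSeq ζ P) (i : ℕ) {a b : ℤ}
    (h : a • P i + b • P (i + 1) = 0) : a = 0 ∧ b = 0 := by
  have h' : a • P i = (-b) • P (i + 1) := by rw [neg_smul]; exact eq_neg_of_add_eq_zero_left h
  have hH := congrArg quadHeight h'
  have hE := congrArg (fun v => |quadEval ζ v|) h'
  simp only [quadHeight_smul, quadEval_smul, abs_mul, Int.natAbs_neg, Int.cast_neg, abs_neg,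
    ← Int.cast_abs, Int.abs_eq_natAbs, Int.cast_natCast] at hH hE
  have h1 := hP.height_lt i
  have h2 := hP.eval_lt i
  have h0 : 0 < quadHeight (P i) :=
    Nat.pos_of_ne_zero fun h => hP.ne_zero i (quadHeight_eq_zero.mp h)
  have key : b = 0 := by
    by_contra hb
    have hb' : 0 < b.natAbs := Int.natAbs_pos.mpr hb
    have hlt : b.natAbs < a.natAbs := by
      by_contra hle
      nlinarith [not_lt.mp hle]
    have hltR : (b.natAbs : ℝ) < a.natAbs := by exact_mod_cast hlt
    have hbR : (0 : ℝ) < b.natAbs := by exact_mod_cast hb'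
    nlinarith [abs_nonneg (quadEval ζ (P i))]
  subst key
  simp only [Int.natAbs_zero, zero_mul, mul_eq_zero, Int.natAbs_eq_zero] at hH
  exact ⟨hH.resolve_right h0.ne', rfl⟩

/-- Two consecutive minimal points span a saturated sublattice. -/
lemma dvd_of_smul_eq (hP : IsMinimalSeq ζ P) (i : ℕ) {r a b : ℤ} (hr : r ≠ 0)
    {w : ℤ × ℤ × ℤ} (h : r • w = a • P i + b • P (i + 1)) : r ∣ a ∧ r ∣ b := by
  obtain ⟨A, hA⟩ := exists_two_mul_natAbs_sub_mul_le a hr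
  obtain ⟨B, hB⟩ := exists_two_mul_natAbs_sub_mul_le b hr
  have h' : r • (w - A • P i - B • P (i + 1)) =
      (a - r * A) • P i + (b - r * B) • P (i + 1) := by
    rw [smul_sub, smul_sub, h, sub_smul, sub_smul, mul_smul, mul_smul]; abel
  set v := w - A • P i - B • P (i + 1)
  have hr0 : 0 < r.natAbs := Int.natAbs_pos.mpr hr
  have hv : v = 0 := by
    by_contra hv
    have hH : r.natAbs * quadHeight v ≤ (a - r * A).natAbs * quadHeight (P i) +
        (b - r * B).natAbs * quadHeight (P (i + 1)) := by
      rw [← quadHeight_smul, h', ← quadHeight_smul, ← quadHeight_smul]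
      exact quadHeight_add_le _ _
    have hE : (r.natAbs : ℝ) * |quadEval ζ v| ≤ ((a - r * A).natAbs : ℝ) * |quadEval ζ (P i)| +
        ((b - r * B).natAbs : ℝ) * |quadEval ζ (P (i + 1))| := by
      simp only [Nat.cast_natAbs, Int.cast_abs, ← abs_mul, ← quadEval_smul, h', quadEval_add]
      exact abs_add_le _ _
    have h1 := hP.height_lt i
    have h2 := hP.eval_lt i
    have hlt : quadHeight v < quadHeight (P (i + 1)) := by
      by_contra hle
      nlinarith [not_lt.mp hle]
    have h3 := hP.eval_le i v hv hlt
    have hA' : 2 * ((a - r * A).natAbs : ℝ) ≤ r.natAbs := by exact_mod_cast hA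
    have hB' : 2 * ((b - r * B).natAbs : ℝ) ≤ r.natAbs := by exact_mod_cast hB
    have hrR : (0 : ℝ) < r.natAbs := by exact_mod_cast hr0
    nlinarith [abs_nonneg (quadEval ζ (P i)), abs_nonneg (quadEval ζ (P (i + 1)))]
  rw [hv, smul_zero] at h'
  obtain ⟨ha, hb⟩ := hP.eq_zero_of_smul_add_smul_eq_zero i h'.symm
  exact ⟨⟨A, by linarith⟩, ⟨B, by linarith⟩⟩

lemma tripleCross_ne_zero (hP : IsMinimalSeq ζ P) (i : ℕ) :
    tripleCross (P i) (P (i + 1)) ≠ 0 := by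
  intro h
  simp only [tripleCross, Prod.mk_eq_zero] at h
  obtain ⟨h1, h2, h3⟩ := h
  have key : ∀ f g : ℤ, f * (P (i + 1)).1 = g * (P i).1 → f * (P (i + 1)).2.1 = g * (P i).2.1 →
      f * (P (i + 1)).2.2 = g * (P i).2.2 → f = 0 := by
    intro f g e1 e2 e3
    refine (hP.eq_zero_of_smul_add_smul_eq_zero i (a := -g) (b := f) ?_).2
    ext <;> simp only [Prod.fst_add, Prod.snd_add, Prod.smul_fst, Prod.smul_snd, smul_eq_mul,
      Prod.fst_zero, Prod.snd_zero] <;> linarith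
  have e1 := key (P i).1 (P (i + 1)).1 (by ring) (by linarith) (by linarith)
  have e2 := key (P i).2.1 (P (i + 1)).2.1 (by linarith) (by ring) (by linarith)
  have e3 := key (P i).2.2 (P (i + 1)).2.2 (by linarith) (by linarith) (by ring)
  exact hP.ne_zero i (Prod.ext e1 (Prod.ext e2 e3))

lemma tripleDot_self_ne_zero {v : ℤ × ℤ × ℤ} (hv : v ≠ 0) : tripleDot v v ≠ 0 := by
  obtain ⟨a, b, c⟩ := v
  contrapose! hv
  simp only [tripleDot] at hv
  have ha : a = 0 := by nlinarith [mul_self_nonneg a, mul_self_nonneg b, mul_self_nonneg c]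
  have hb : b = 0 := by nlinarith [mul_self_nonneg a, mul_self_nonneg b, mul_self_nonneg c]
  have hc : c = 0 := by nlinarith [mul_self_nonneg a, mul_self_nonneg b, mul_self_nonneg c]
  simp [ha, hb, hc]

lemma natAbs_tripleCross_fst_eq (hP : IsMinimalSeq ζ P) (i : ℕ)
    (h : tripleDot (P (i + 2)) (tripleCross (P i) (P (i + 1))) = 0) :
    (tripleCross (P (i + 1)) (P (i + 2))).1.natAbs =
      (tripleCross (P i) (P (i + 1))).1.natAbs := by
  set n := tripleCross (P i) (P (i + 1)) with hn
  have hN := tripleDot_self_ne_zero (hP.tripleCross_ne_zero i)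
  rw [← hn] at hN
  have hid : tripleDot n n • P (i + 2) =
      (tripleDot (tripleCross (P (i + 2)) (P (i + 1))) n) • P i +
      (tripleDot (tripleCross (P i) (P (i + 2))) n) • P (i + 1) := by
    have : tripleDot n n • P (i + 2) - (tripleDot (tripleCross (P (i + 2)) (P (i + 1))) n) • P i -
      (tripleDot (tripleCross (P i) (P (i + 2))) n) • P (i + 1) =
      tripleDot (P (i + 2)) n • n := by
      ext <;> simp only [hn, tripleDot, tripleCross, Prod.fst_sub, Prod.snd_sub, Prod.smul_fst,
        Prod.smul_snd, smul_eq_mul] <;> ring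
    rw [h, zero_smul, sub_sub, sub_eq_zero] at this
    exact this
  obtain ⟨⟨A, hA⟩, ⟨B, hB⟩⟩ := hP.dvd_of_smul_eq i hN hid
  have hc : P (i + 2) = A • P i + B • P (i + 1) := by
    rw [hA, hB, mul_smul, mul_smul, ← smul_add] at hid
    exact smul_right_injective _ hN hid
  have hA0 : A ≠ 0 := by
    rintro rfl
    have := hP.eq_zero_of_smul_add_smul_eq_zero (i + 1) (a := -B) (b := 1)
      (by rw [hc]; simp)
    exact one_ne_zero this.2
  have hA1 := (hP.dvd_of_smul_eq (i + 1) (w := P i) (a := -B) (b := 1) hA0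
    (by rw [show i + 1 + 1 = i + 2 from rfl, hc]; simp)).2
  have hx : (tripleCross (P (i + 1)) (P (i + 2))).1 = -A * n.1 := by
    rw [hc, hn]
    simp only [tripleCross, Prod.fst_add, Prod.snd_add, Prod.smul_fst, Prod.smul_snd, smul_eq_mul]
    ring
  rw [hx, Int.natAbs_mul, Int.natAbs_neg, Int.natAbs_of_isUnit (isUnit_of_dvd_one hA1), one_mul]

end IsMinimalSeq

/-- The sequence of heights of a sequence of integer triples. -/
noncomputable def seqHeight (P : ℕ → ℤ × ℤ × ℤ) (i : ℕ) : ℝ := quadHeight (P i)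

/-- The cross products of consecutive terms of a sequence of integer triples. -/
def crossSeq (P : ℕ → ℤ × ℤ × ℤ) (i : ℕ) : ℤ × ℤ × ℤ := tripleCross (P i) (P (i + 1))

/-- The error of `x.2.1` as an approximation to `x.1 * ζ`. -/
def linErr (ζ : ℝ) (x : ℤ × ℤ × ℤ) : ℝ := x.1 * ζ - x.2.1

/-- The error of `x.2.2` as an approximation to `x.1 * ζ ^ 2`. -/
def quadErr (ζ : ℝ) (x : ℤ × ℤ × ℤ) : ℝ := x.1 * ζ ^ 2 - x.2.2

/-- The determinant of the symmetric matrix attached to a triple. -/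
def tripleDisc (x : ℤ × ℤ × ℤ) : ℤ := x.1 * x.2.2 - x.2.1 ^ 2

lemma linErr_tripleCross (ζ : ℝ) (v w : ℤ × ℤ × ℤ) :
    linErr ζ (tripleCross v w) = w.2.2 * quadEval ζ v - v.2.2 * quadEval ζ w := by
  simp only [linErr, tripleCross, quadEval]; push_cast; ring

lemma quadErr_tripleCross (ζ : ℝ) (v w : ℤ × ℤ × ℤ) :
    quadErr ζ (tripleCross v w) = v.2.1 * quadEval ζ w - w.2.1 * quadEval ζ v := by
  simp only [quadErr, tripleCross, quadEval]; push_cast; ring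

lemma abs_mul_sub_mul_le {a b x y M E : ℝ} (ha : |a| ≤ M) (hb : |b| ≤ M) (hx : |x| ≤ E)
    (hy : |y| ≤ E) : |a * x - b * y| ≤ 2 * (M * E) := by
  have h1 : |a * x| ≤ M * E := by
    rw [abs_mul]; exact mul_le_mul ha hx (abs_nonneg _) ((abs_nonneg _).trans ha)
  have h2 : |b * y| ≤ M * E := by
    rw [abs_mul]; exact mul_le_mul hb hy (abs_nonneg _) ((abs_nonneg _).trans ha)
  linarith [abs_sub (a * x) (b * y)]

lemma abs_le_quadHeight_of_isCoprime {s t : ℤ} (hs : s ≠ 0) (hst : IsCoprime s t)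
    {v : ℤ × ℤ × ℤ} (hv : v ≠ 0) (h : v.1 * s ^ 2 + v.2.1 * (s * t) + v.2.2 * t ^ 2 = 0) :
    |(s : ℝ)| ≤ quadHeight v := by
  have key : ∀ a : ℤ, s ∣ a → a ≠ 0 → |(s : ℝ)| ≤ |(a : ℝ)| := fun a hd ha => by
    exact_mod_cast Int.le_of_dvd (abs_pos.mpr ha) ((abs_dvd_abs s a).mpr hd)
  by_cases hc : v.2.2 = 0
  · have h1 : v.1 * s + v.2.1 * t = 0 := by
      rw [hc] at h
      exact (mul_eq_zero.mp (show s * (v.1 * s + v.2.1 * t) = 0 by linarith)).resolve_left hs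
    by_cases hb : v.2.1 = 0
    · have ha : v.1 = 0 := by
        rw [hb] at h1
        exact (mul_eq_zero.mp (show v.1 * s = 0 by linarith)).resolve_right hs
      exact absurd (Prod.ext ha (Prod.ext hb hc)) hv
    · refine (key _ (hst.dvd_of_dvd_mul_right (y := v.2.1) ?_) hb).trans (abs_snd_le_quadHeight v)
      exact ⟨-v.1, by linarith⟩
  · refine (key _ ((hst.pow_right (n := 2)).dvd_of_dvd_mul_right ?_) hc).trans
      (abs_thd_le_quadHeight v)
    exact ⟨-(v.1 * s + v.2.1 * t), by linarith⟩

lemma exists_eq_of_tripleDisc_eq_zero {x : ℤ × ℤ × ℤ} (hx : x.1 ≠ 0) (h : tripleDisc x = 0) :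
    ∃ k s t : ℤ, k ≠ 0 ∧ s ≠ 0 ∧ IsCoprime s t ∧ x = (k * s ^ 2, k * (s * t), k * t ^ 2) := by
  obtain ⟨a, b, c⟩ := x
  simp only [tripleDisc] at h hx
  obtain ⟨s, hs⟩ := Int.gcd_dvd_left a b
  obtain ⟨t, ht⟩ := Int.gcd_dvd_right a b
  have hst : IsCoprime s t := by
    rw [Int.isCoprime_iff_gcd_eq_one]
    have hg : 0 < a.gcd b := Int.gcd_pos_of_ne_zero_left _ hx
    have := Int.gcd_ediv_gcd_ediv_gcd hg
    rwa [Int.ediv_eq_of_eq_mul_right (by exact_mod_cast hg.ne') hs,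
      Int.ediv_eq_of_eq_mul_right (by exact_mod_cast hg.ne') ht] at this
  set g : ℤ := (a.gcd b : ℤ)
  have hs0 : s ≠ 0 := by rintro rfl; exact hx (by rw [hs, mul_zero])
  have hg0 : g ≠ 0 := by intro hg; exact hx (by rw [hs, hg, zero_mul])
  have h1 : s * c = g * t ^ 2 := by
    have : g * (s * c - g * t ^ 2) = 0 := by
      rw [hs, ht] at h; linarith
    exact sub_eq_zero.mp ((mul_eq_zero.mp this).resolve_left hg0)
  obtain ⟨k, hk⟩ : s ∣ g := (hst.pow_right (n := 2)).dvd_of_dvd_mul_right ⟨c, h1.symm⟩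
  refine ⟨k, s, t, ?_, hs0, hst, ?_⟩
  · rintro rfl; exact hg0 (by rw [hk, mul_zero])
  · have h2 : c = k * t ^ 2 := mul_left_cancel₀ hs0 (by rw [h1, hk]; ring)
    ext
    · change a = _; rw [hs, hk]; ring
    · change b = _; rw [ht, hk]; ring
    · exact h2

lemma abs_crossSeq_fst_le (P : ℕ → ℤ × ℤ × ℤ) (i : ℕ) :
    |((crossSeq P i).1 : ℝ)| ≤ 2 * (seqHeight P i * seqHeight P (i + 1)) := by
  have h := abs_mul_sub_mul_le (abs_snd_le_quadHeight (P i)) (abs_thd_le_quadHeight (P i))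
    (abs_thd_le_quadHeight (P (i + 1))) (abs_snd_le_quadHeight (P (i + 1)))
  simpa [crossSeq, tripleCross, seqHeight] using h

namespace IsMinimalSeq

open Filter

variable {ζ : ℝ} {P : ℕ → ℤ × ℤ × ℤ}

lemma strictMono_seqHeight (hP : IsMinimalSeq ζ P) : StrictMono (seqHeight P) :=
  strictMono_nat_of_lt_succ fun i => Nat.cast_lt.mpr (hP.height_lt i)

lemma tendsto_seqHeight (hP : IsMinimalSeq ζ P) : Tendsto (seqHeight P) atTop atTop :=
  tendsto_natCast_atTop_atTop.comp
    (strictMono_nat_of_lt_succ fun i => hP.height_lt i).tendsto_atTop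

lemma one_le_seqHeight (hP : IsMinimalSeq ζ P) (i : ℕ) : 1 ≤ seqHeight P i := by
  rw [seqHeight, Nat.one_le_cast]
  exact Nat.pos_of_ne_zero fun h => hP.ne_zero i (quadHeight_eq_zero.mp h)

lemma eventually_le_rpow (hP : IsMinimalSeq ζ P) (K : ℝ) {ε : ℝ} (hε : 0 < ε) :
    ∀ᶠ i in atTop, K ≤ seqHeight P i ^ ε :=
  ((tendsto_rpow_atTop hε).comp hP.tendsto_seqHeight).eventually_ge_atTop K

lemma eventually_succ (hP : IsMinimalSeq ζ P) (K : ℝ) {ε : ℝ} (hε : 0 < ε) :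
    ∀ᶠ i in atTop, K ≤ seqHeight P (i + 1) ^ ε :=
  (tendsto_add_atTop_nat 1).eventually (hP.eventually_le_rpow K hε)

lemma eventually_abs_quadEval_le (hP : IsMinimalSeq ζ P) (hζ : IsExtremal ζ) :
    ∀ᶠ i in atTop, |quadEval ζ (P i)| ≤ seqHeight P (i + 1) ^ (-2.6177 : ℝ) := by
  obtain ⟨X₀, hX⟩ := exists_quadEval_le_of_isExtremal hζ
  filter_upwards [hP.eventually_succ (2 * X₀) one_pos,
    hP.eventually_succ ((1 / 2 : ℝ) ^ (-(26178 / 10000 : ℝ))) (ε := 0.0001) (by norm_num)]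
    with i h1 h2
  have h0 : 0 < seqHeight P (i + 1) := zero_lt_one.trans_le (hP.one_le_seqHeight _)
  rw [Real.rpow_one] at h1
  obtain ⟨v, hv, hpos, hle⟩ := hX (1 / 2 * seqHeight P (i + 1)) (by linarith)
  have hv0 : v ≠ 0 := by rintro rfl; simp [quadEval] at hpos
  refine ((hP.eval_le i v hv0 ?_).trans hle).trans ?_
  · have : (quadHeight v : ℝ) < seqHeight P (i + 1) := by linarith
    exact Nat.cast_lt.mp this
  · rw [Real.mul_rpow (by norm_num) h0.le]
    refine (mul_le_mul_of_nonneg_right h2 (Real.rpow_nonneg h0.le _)).trans_eq ?_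
    rw [← Real.rpow_add h0]
    norm_num

lemma eventually_abs_err_le (hP : IsMinimalSeq ζ P) (hζ : IsExtremal ζ) :
    ∀ᶠ i in atTop, |linErr ζ (crossSeq P i)| ≤ seqHeight P (i + 1) ^ (-1.6176 : ℝ) ∧
      |quadErr ζ (crossSeq P i)| ≤ seqHeight P (i + 1) ^ (-1.6176 : ℝ) := by
  filter_upwards [hP.eventually_abs_quadEval_le hζ,
    hP.eventually_succ 2 (ε := 0.0001) (by norm_num)] with i h1 h2
  have h0 : 0 < seqHeight P (i + 1) := zero_lt_one.trans_le (hP.one_le_seqHeight _)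
  have hle : (quadHeight (P i) : ℝ) ≤ seqHeight P (i + 1) :=
    (hP.strictMono_seqHeight (Nat.lt_succ_self i)).le
  have h3 : 2 * (seqHeight P (i + 1) * seqHeight P (i + 1) ^ (-2.6177 : ℝ)) ≤
      seqHeight P (i + 1) ^ (-1.6176 : ℝ) := by
    calc _ ≤ seqHeight P (i + 1) ^ (0.0001 : ℝ) *
        (seqHeight P (i + 1) ^ (1 : ℝ) * seqHeight P (i + 1) ^ (-2.6177 : ℝ)) := by
          rw [Real.rpow_one]; gcongr
      _ = _ := by rw [← Real.rpow_add h0, ← Real.rpow_add h0]; norm_num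
  rw [crossSeq, linErr_tripleCross, quadErr_tripleCross]
  have he := (hP.eval_lt i).le.trans h1
  exact ⟨(abs_mul_sub_mul_le (abs_thd_le_quadHeight _)
    ((abs_thd_le_quadHeight _).trans hle) h1 he).trans h3,
    (abs_mul_sub_mul_le ((abs_snd_le_quadHeight _).trans hle) (abs_snd_le_quadHeight _)
      he h1).trans h3⟩

end IsMinimalSeq

namespace IsMinimalSeq

open Filter

variable {ζ : ℝ} {P : ℕ → ℤ × ℤ × ℤ}

lemma exists_abs_le_of_crossSeq_eq (hP : IsMinimalSeq ζ P) (hζ : IsExtremal ζ) :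
    ∃ S : ℝ, ∀ᶠ i in atTop, ∀ k s t : ℤ, k ≠ 0 → s ≠ 0 → IsCoprime s t →
      crossSeq P i = (k * s ^ 2, k * (s * t), k * t ^ 2) → |(s : ℝ)| ≤ S := by
  obtain ⟨M, hM⟩ := eventually_atTop.mp (hP.eventually_abs_quadEval_le hζ)
  refine ⟨max (seqHeight P M) 4, ?_⟩
  filter_upwards [hP.eventually_abs_err_le hζ, eventually_ge_atTop M,
    hP.eventually_succ 4 (ε := 0.6176) (by norm_num)] with i ⟨hp, hq⟩ hi h4 k s t hk hs hst hx
  let F : ℕ → ℤ := fun m => (P m).1 * s ^ 2 + (P m).2.1 * (s * t) + (P m).2.2 * t ^ 2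
  have hF : F (i + 1) = 0 := by
    have h1 : (P (i + 1)).1 * (crossSeq P i).1 + (P (i + 1)).2.1 * (crossSeq P i).2.1 +
        (P (i + 1)).2.2 * (crossSeq P i).2.2 = 0 := by
      simp only [crossSeq, tripleCross]; ring
    rw [hx] at h1
    exact (mul_eq_zero.mp (show k * F (i + 1) = 0 by simp only [F]; linarith)).resolve_left hk
  by_cases hFM : F M = 0
  · exact (abs_le_quadHeight_of_isCoprime hs hst (hP.ne_zero M) hFM).trans (le_max_left _ _)
  obtain ⟨m, hMm, hmi, hFm, hFm'⟩ : ∃ m, M ≤ m ∧ m ≤ i ∧ F m ≠ 0 ∧ F (m + 1) = 0 := by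
    by_contra! hcon
    exact hFM (Nat.decreasingInduction' (P := fun m => F m = 0) (n := i + 1)
      (fun m hm hMm ih => by
        by_contra h
        exact hcon m hMm (by omega) h ih) (by omega) hF)
  refine le_trans ?_ (le_max_right _ _)
  have hsH := abs_le_quadHeight_of_isCoprime hs hst (hP.ne_zero (m + 1)) hFm'
  have hH0 : 0 < seqHeight P (i + 1) := zero_lt_one.trans_le (hP.one_le_seqHeight _)
  have hmH : (quadHeight (P m) : ℝ) ≤ seqHeight P (i + 1) :=
    (hP.strictMono_seqHeight (show m < i + 1 by omega)).le
  have hkR : (1 : ℝ) ≤ |(k : ℝ)| := by exact_mod_cast Int.one_le_abs hk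
  have hp' : |(s : ℝ) ^ 2 * ζ - s * t| ≤ seqHeight P (i + 1) ^ (-1.6176 : ℝ) := by
    refine le_trans ?_ hp
    have : linErr ζ (crossSeq P i) = k * ((s : ℝ) ^ 2 * ζ - s * t) := by
      rw [hx, linErr]; push_cast; ring
    rw [this, abs_mul]
    exact le_mul_of_one_le_left (abs_nonneg _) hkR
  have hq' : |(s : ℝ) ^ 2 * ζ ^ 2 - t ^ 2| ≤ seqHeight P (i + 1) ^ (-1.6176 : ℝ) := by
    refine le_trans ?_ hq
    have : quadErr ζ (crossSeq P i) = k * ((s : ℝ) ^ 2 * ζ ^ 2 - t ^ 2) := by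
      rw [hx, quadErr]; push_cast; ring
    rw [this, abs_mul]
    exact le_mul_of_one_le_left (abs_nonneg _) hkR
  have hsmall : 2 * (seqHeight P (i + 1) * seqHeight P (i + 1) ^ (-1.6176 : ℝ)) ≤ 1 / 2 := by
    have : seqHeight P (i + 1) * seqHeight P (i + 1) ^ (-1.6176 : ℝ) =
        (seqHeight P (i + 1) ^ (0.6176 : ℝ))⁻¹ := by
      rw [← Real.rpow_neg hH0.le]
      nth_rw 1 [← Real.rpow_one (seqHeight P (i + 1))]
      rw [← Real.rpow_add hH0]; norm_num
    rw [this]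
    have := inv_anti₀ (by norm_num) h4
    linarith
  have hsum := abs_mul_sub_mul_le ((abs_snd_le_quadHeight (P m)).trans hmH)
    (b := -((P m).2.2 : ℝ)) (by rw [abs_neg]; exact (abs_thd_le_quadHeight (P m)).trans hmH) hp' hq'
  have hFR : (1 : ℝ) ≤ |(F m : ℝ)| := by exact_mod_cast Int.one_le_abs hFm
  have hid : (s : ℝ) ^ 2 * quadEval ζ (P m) = F m + ((P m).2.1 * ((s : ℝ) ^ 2 * ζ - s * t) -
      (-((P m).2.2 : ℝ)) * ((s : ℝ) ^ 2 * ζ ^ 2 - t ^ 2)) := by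
    simp only [F, quadEval]; push_cast; ring
  have hlow : 1 / 2 ≤ (s : ℝ) ^ 2 * |quadEval ζ (P m)| := by
    have h1 : (s : ℝ) ^ 2 * |quadEval ζ (P m)| = |(s : ℝ) ^ 2 * quadEval ζ (P m)| := by
      rw [abs_mul, abs_of_nonneg (sq_nonneg (s : ℝ))]
    rw [h1, hid]
    have h2 := abs_sub_abs_le_abs_sub (F m : ℝ) (-((P m).2.1 * ((s : ℝ) ^ 2 * ζ - s * t) -
      (-((P m).2.2 : ℝ)) * ((s : ℝ) ^ 2 * ζ ^ 2 - t ^ 2)))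
    rw [abs_neg, sub_neg_eq_add] at h2
    linarith
  have hs1 : (1 : ℝ) ≤ |(s : ℝ)| := by exact_mod_cast Int.one_le_abs hs
  have hs0 : 0 < |(s : ℝ)| := zero_lt_one.trans_le hs1
  have hup : |quadEval ζ (P m)| ≤ |(s : ℝ)| ^ (-2.5 : ℝ) :=
    (hM m hMm).trans <| (Real.rpow_le_rpow_of_nonpos hs0 hsH (by norm_num)).trans
      (Real.rpow_le_rpow_of_exponent_le hs1 (by norm_num))
  have h5 : 1 / 2 ≤ |(s : ℝ)| ^ (-(1 / 2) : ℝ) := by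
    calc (1 / 2 : ℝ) ≤ |(s : ℝ)| ^ 2 * |(s : ℝ)| ^ (-2.5 : ℝ) := by
          rw [sq_abs]
          exact hlow.trans (mul_le_mul_of_nonneg_left hup (sq_nonneg _))
      _ = _ := by
          rw [← Real.rpow_natCast, ← Real.rpow_add hs0]; norm_num
  rw [Real.rpow_neg hs0.le, ← Real.sqrt_eq_rpow, one_div] at h5
  have h6 : Real.sqrt |(s : ℝ)| ≤ 2 := (inv_le_inv₀ (by norm_num) (Real.sqrt_pos.mpr hs0)).mp h5
  rw [Real.sqrt_le_left (by norm_num)] at h6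
  linarith

lemma eventually_tripleDisc_ne_zero (hP : IsMinimalSeq ζ P) (hζ : IsExtremal ζ) :
    ∀ᶠ i in atTop, tripleDisc (crossSeq P i) ≠ 0 := by
  obtain ⟨S, hS⟩ := hP.exists_abs_le_of_crossSeq_eq hζ
  have hirr : ∀ s : ℤ, s ≠ 0 → 0 < |(s : ℝ) * ζ - round ((s : ℝ) * ζ)| := by
    intro s hs
    rw [abs_pos]
    have h := quadEval_ne_zero hζ.1 (v := (-round ((s : ℝ) * ζ), s, 0)) (by simp [hs])
    simp only [quadEval, Int.cast_neg, Int.cast_zero, zero_mul, add_zero] at h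
    rwa [sub_eq_add_neg, add_comm]
  have hfin : ∀ᶠ i in atTop, ∀ s ∈ Set.Icc (-⌈S⌉) ⌈S⌉, s ≠ 0 →
      seqHeight P (i + 1) ^ (-1.6176 : ℝ) < |(s : ℝ) * ζ - round ((s : ℝ) * ζ)| := by
    rw [eventually_all_finite (Set.finite_Icc _ _)]
    intro s _
    by_cases hs : s = 0
    · simp [hs]
    · have h0 := ((tendsto_rpow_neg_atTop (show (0 : ℝ) < 1.6176 by norm_num)).comp
        hP.tendsto_seqHeight).comp (tendsto_add_atTop_nat 1)
      filter_upwards [h0.eventually_lt_const (hirr s hs)] with i hi _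
      exact hi
  filter_upwards [hS, hfin, hP.eventually_abs_err_le hζ,
    hP.eventually_succ 2 (ε := 1.6176) (by norm_num)] with i hSi hfi ⟨hp, hq⟩ h2 hD
  have hx0 := hP.tripleCross_ne_zero i
  change crossSeq P i ≠ 0 at hx0
  by_cases h0 : (crossSeq P i).1 = 0
  · have h1 : (crossSeq P i).2.1 = 0 := by
      rw [tripleDisc, h0, zero_mul, zero_sub, neg_eq_zero] at hD
      exact pow_eq_zero_iff (two_ne_zero) |>.mp hD
    refine hx0 (Prod.ext h0 (Prod.ext h1 ?_))
    have h3 : |((crossSeq P i).2.2 : ℝ)| < 1 := by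
      rw [quadErr, h0, Int.cast_zero, zero_mul, zero_sub, abs_neg] at hq
      refine hq.trans_lt ?_
      rw [Real.rpow_neg (zero_le_one.trans (hP.one_le_seqHeight _))]
      exact inv_lt_one_of_one_lt₀ (by linarith)
    exact Int.abs_lt_one_iff.mp (by exact_mod_cast h3)
  · obtain ⟨k, s, t, hk, hs, hst, hx⟩ := exists_eq_of_tripleDisc_eq_zero h0 hD
    have hsS := hSi k s t hk hs hst hx
    have hmem : s ∈ Set.Icc (-⌈S⌉) ⌈S⌉ := by
      rw [Set.mem_Icc, ← abs_le]
      have := hsS.trans (Int.le_ceil S)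
      exact_mod_cast this
    refine (hfi s hmem hs).not_ge ((round_le _ t).trans (le_trans ?_ hp))
    have hkR : (1 : ℝ) ≤ |(k : ℝ)| := by exact_mod_cast Int.one_le_abs hk
    have hsR : (1 : ℝ) ≤ |(s : ℝ)| := by exact_mod_cast Int.one_le_abs hs
    have : linErr ζ (crossSeq P i) = k * s * (s * ζ - t) := by
      rw [hx, linErr]; push_cast; ring
    rw [this, abs_mul, abs_mul]
    exact le_mul_of_one_le_left (abs_nonneg _) (one_le_mul_of_one_le_of_one_le hkR hsR)

end IsMinimalSeq

lemma abs_mul_le_rpow {H a b c f g : ℝ} (hH : 1 ≤ H) (hf : |f| ≤ H ^ a) (hg : |g| ≤ H ^ b)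
    (h : a + b ≤ c) : |f * g| ≤ H ^ c := by
  rw [abs_mul]
  calc |f| * |g| ≤ H ^ a * H ^ b :=
        mul_le_mul hf hg (abs_nonneg _) (Real.rpow_nonneg (zero_le_one.trans hH) _)
    _ = H ^ (a + b) := (Real.rpow_add (zero_lt_one.trans_le hH) _ _).symm
    _ ≤ H ^ c := Real.rpow_le_rpow_of_exponent_le hH h

lemma abs_add_le_rpow {H ε a b c f g : ℝ} (hH : 1 ≤ H) (hε : 2 ≤ H ^ ε) (hf : |f| ≤ H ^ a)
    (hg : |g| ≤ H ^ b) (ha : ε + a ≤ c) (hb : ε + b ≤ c) : |f + g| ≤ H ^ c := by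
  have hm : ∀ {x : ℝ}, ε + x ≤ c → H ^ x ≤ H ^ (c - ε) := fun h =>
    Real.rpow_le_rpow_of_exponent_le hH (by linarith)
  calc |f + g| ≤ |f| + |g| := abs_add_le _ _
    _ ≤ 2 * H ^ (c - ε) := by linarith [hm ha, hm hb]
    _ ≤ H ^ ε * H ^ (c - ε) :=
        mul_le_mul_of_nonneg_right hε (Real.rpow_nonneg (zero_le_one.trans hH) _)
    _ = H ^ c := by rw [← Real.rpow_add (zero_lt_one.trans_le hH)]; ring_nf

lemma abs_sub_le_rpow {H ε a b c f g : ℝ} (hH : 1 ≤ H) (hε : 2 ≤ H ^ ε) (hf : |f| ≤ H ^ a)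
    (hg : |g| ≤ H ^ b) (ha : ε + a ≤ c) (hb : ε + b ≤ c) : |f - g| ≤ H ^ c := by
  rw [sub_eq_add_neg]
  exact abs_add_le_rpow hH hε hf (by rwa [abs_neg]) ha hb

lemma rpow_neg_le_half {H ε : ℝ} (hH : 1 ≤ H) (hε : 2 ≤ H ^ ε) {a : ℝ} (h : a ≤ -ε) :
    H ^ a ≤ 1 / 2 := by
  calc H ^ a ≤ H ^ (-ε) := Real.rpow_le_rpow_of_exponent_le hH h
    _ = (H ^ ε)⁻¹ := Real.rpow_neg (zero_le_one.trans hH) _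
    _ ≤ 1 / 2 := by rw [one_div]; exact inv_anti₀ two_pos hε

lemma rpow_le_of_half_le_mul {H ε : ℝ} (hH : 1 ≤ H) (hε : 2 ≤ H ^ ε) {a b y : ℝ}
    (hy : 1 / 2 ≤ y * H ^ (-a)) (h : b ≤ a - ε) : H ^ b ≤ y := by
  have h0 : 0 < H := zero_lt_one.trans_le hH
  calc H ^ b ≤ H ^ (a - ε) := Real.rpow_le_rpow_of_exponent_le hH h
    _ = H ^ a * (H ^ ε)⁻¹ := by rw [sub_eq_add_neg, Real.rpow_add h0, Real.rpow_neg h0.le]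
    _ ≤ H ^ a * (1 / 2) := by
        rw [one_div]
        exact mul_le_mul_of_nonneg_left (inv_anti₀ two_pos hε) (Real.rpow_nonneg h0.le _)
    _ ≤ H ^ a * (y * H ^ (-a)) := mul_le_mul_of_nonneg_left hy (Real.rpow_nonneg h0.le _)
    _ = y := by rw [Real.rpow_neg h0.le]; field_simp

/-- The quantity `2 * ζ * linErr ζ x - quadErr ζ x`, which governs `tripleDisc x`. -/
def discErr (ζ : ℝ) (x : ℤ × ℤ × ℤ) : ℝ := 2 * ζ * linErr ζ x - quadErr ζ x

lemma cast_tripleDisc (ζ : ℝ) (x : ℤ × ℤ × ℤ) :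
    (tripleDisc x : ℝ) = x.1 * discErr ζ x - linErr ζ x * linErr ζ x := by
  simp only [tripleDisc, discErr, linErr, quadErr]; push_cast; ring

lemma cast_tripleDot (ζ : ℝ) (v x : ℤ × ℤ × ℤ) :
    (tripleDot v x : ℝ) =
      x.1 * quadEval ζ v - (v.2.1 * linErr ζ x - -(v.2.2 : ℝ) * quadErr ζ x) := by
  simp only [tripleDot, quadEval, linErr, quadErr]; push_cast; ring

namespace IsMinimalSeq

open Filter

variable {ζ : ℝ} {P : ℕ → ℤ × ℤ × ℤ}

lemma eventually_abs_discErr_le (hP : IsMinimalSeq ζ P) (hζ : IsExtremal ζ) :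
    ∀ᶠ i in atTop, |discErr ζ (crossSeq P i)| ≤ seqHeight P (i + 1) ^ (-1.61758 : ℝ) := by
  filter_upwards [hP.eventually_abs_err_le hζ, hP.eventually_succ 2 (ε := 0.00001) (by norm_num),
    hP.eventually_succ |2 * ζ| (ε := 0.00001) (by norm_num)] with i ⟨hp, hq⟩ h2 h3
  have hH := hP.one_le_seqHeight (i + 1)
  exact abs_sub_le_rpow hH h2 (abs_mul_le_rpow hH h3 hp le_rfl) hq (by norm_num) (by norm_num)

lemma eventually_le_abs_crossSeq_fst (hP : IsMinimalSeq ζ P) (hζ : IsExtremal ζ) :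
    ∀ᶠ i in atTop, seqHeight P (i + 1) ^ (1.6175 : ℝ) ≤ |((crossSeq P i).1 : ℝ)| := by
  filter_upwards [hP.eventually_abs_err_le hζ, hP.eventually_succ 2 (ε := 0.00001) (by norm_num),
    hP.eventually_abs_discErr_le hζ, hP.eventually_tripleDisc_ne_zero hζ] with i ⟨hp, _⟩ h2 hu hD
  have hH := hP.one_le_seqHeight (i + 1)
  refine rpow_le_of_half_le_mul hH h2 (a := 1.61758) ?_ (by norm_num)
  have h1 : (1 : ℝ) ≤ |(tripleDisc (crossSeq P i) : ℝ)| := by exact_mod_cast Int.one_le_abs hD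
  rw [cast_tripleDisc ζ] at h1
  have h3 := (abs_mul_le_rpow hH hp hp (c := -3.2352) (by norm_num)).trans
    (rpow_neg_le_half hH h2 (by norm_num))
  have h4 := h1.trans (abs_sub _ _)
  rw [abs_mul _ (discErr _ _)] at h4
  have h5 := mul_le_mul_of_nonneg_left hu (abs_nonneg ((crossSeq P i).1 : ℝ))
  linarith

lemma eventually_seqHeight_succ_le (hP : IsMinimalSeq ζ P) (hζ : IsExtremal ζ) :
    ∀ᶠ i in atTop, seqHeight P (i + 1) ≤ seqHeight P i ^ (1.62 : ℝ) := by
  filter_upwards [hP.eventually_le_abs_crossSeq_fst hζ,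
    hP.eventually_le_rpow 2 (ε := 0.00001) (by norm_num)] with i h1 h2
  have h0 : 0 < seqHeight P (i + 1) := zero_lt_one.trans_le (hP.one_le_seqHeight _)
  have h0' : 0 < seqHeight P i := zero_lt_one.trans_le (hP.one_le_seqHeight _)
  have h3 := h1.trans (abs_crossSeq_fst_le P i)
  have h4 : seqHeight P (i + 1) ^ (0.6175 : ℝ) ≤ seqHeight P i ^ (1.00001 : ℝ) := by
    have e1 : seqHeight P (i + 1) ^ (1.6175 : ℝ) =
        seqHeight P (i + 1) ^ (0.6175 : ℝ) * seqHeight P (i + 1) := by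
      nth_rw 3 [← Real.rpow_one (seqHeight P (i + 1))]
      rw [← Real.rpow_add h0]; norm_num
    have e2 : seqHeight P i ^ (1.00001 : ℝ) = seqHeight P i ^ (0.00001 : ℝ) * seqHeight P i := by
      nth_rw 3 [← Real.rpow_one (seqHeight P i)]
      rw [← Real.rpow_add h0']; norm_num
    rw [e1] at h3
    rw [e2]
    refine le_of_mul_le_mul_right (h3.trans ?_) h0
    rw [← mul_assoc]
    gcongr
  calc seqHeight P (i + 1) = (seqHeight P (i + 1) ^ (0.6175 : ℝ)) ^ (1 / 0.6175 : ℝ) := by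
        rw [← Real.rpow_mul h0.le]; norm_num
    _ ≤ (seqHeight P i ^ (1.00001 : ℝ)) ^ (1 / 0.6175 : ℝ) := by gcongr
    _ = seqHeight P i ^ (1.00001 * (1 / 0.6175) : ℝ) := (Real.rpow_mul h0'.le _ _).symm
    _ ≤ _ := Real.rpow_le_rpow_of_exponent_le (hP.one_le_seqHeight _) (by norm_num)

lemma eventually_rpow_le_seqHeight (hP : IsMinimalSeq ζ P) (hζ : IsExtremal ζ) :
    ∀ᶠ i in atTop, tripleDot (P (i + 2)) (crossSeq P i) ≠ 0 →
      seqHeight P (i + 1) ^ (1.6175 : ℝ) ≤ seqHeight P (i + 2) := by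
  filter_upwards [hP.eventually_abs_err_le hζ, hP.eventually_succ 2 (ε := 0.00001) (by norm_num),
    (tendsto_add_atTop_nat 2).eventually (hP.eventually_abs_quadEval_le hζ)]
    with i ⟨hp, hq⟩ h2 he hdot
  have hH := hP.one_le_seqHeight (i + 1)
  have h0 : 0 < seqHeight P (i + 1) := zero_lt_one.trans_le hH
  have hH2 : seqHeight P (i + 1) ≤ seqHeight P (i + 3) :=
    (hP.strictMono_seqHeight (by omega)).le
  have hx : |((crossSeq P i).1 : ℝ)| ≤ seqHeight P (i + 1) ^ (2.00001 : ℝ) := by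
    refine (abs_crossSeq_fst_le P i).trans ?_
    have hle : seqHeight P i ≤ seqHeight P (i + 1) := (hP.strictMono_seqHeight (by omega)).le
    calc 2 * (seqHeight P i * seqHeight P (i + 1))
        ≤ seqHeight P (i + 1) ^ (0.00001 : ℝ) * (seqHeight P (i + 1) ^ (2 : ℝ)) := by
          rw [Real.rpow_two, sq]; gcongr
          exact mul_nonneg (zero_le_one.trans (hP.one_le_seqHeight i)) h0.le
      _ = _ := by rw [← Real.rpow_add h0]; norm_num
  have he' : |quadEval ζ (P (i + 2))| ≤ seqHeight P (i + 1) ^ (-2.6177 : ℝ) :=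
    he.trans (Real.rpow_le_rpow_of_nonpos h0 hH2 (by norm_num))
  have h3 := (abs_mul_le_rpow hH hx he' (c := -0.6) (by norm_num)).trans
    (rpow_neg_le_half hH h2 (by norm_num))
  have h4 := abs_mul_sub_mul_le (abs_snd_le_quadHeight (P (i + 2))) (b := -((P (i + 2)).2.2 : ℝ))
    (by rw [abs_neg]; exact abs_thd_le_quadHeight (P (i + 2))) hp hq
  have h1 : (1 : ℝ) ≤ |(tripleDot (P (i + 2)) (crossSeq P i) : ℝ)| := by
    exact_mod_cast Int.one_le_abs hdot
  rw [cast_tripleDot ζ] at h1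
  have h5 := h1.trans (abs_sub _ _)
  refine rpow_le_of_half_le_mul hH h2 (a := 1.61759) ?_ (by norm_num)
  have h6 : 2 * seqHeight P (i + 1) ^ (-1.6176 : ℝ) ≤ seqHeight P (i + 1) ^ (-1.61759 : ℝ) := by
    calc _ ≤ seqHeight P (i + 1) ^ (0.00001 : ℝ) * seqHeight P (i + 1) ^ (-1.6176 : ℝ) := by gcongr
      _ = _ := by rw [← Real.rpow_add h0]; norm_num
  have h7 : 2 * (seqHeight P (i + 2) * seqHeight P (i + 1) ^ (-1.6176 : ℝ)) ≤
      seqHeight P (i + 2) * seqHeight P (i + 1) ^ (-1.61759 : ℝ) := by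
    rw [mul_left_comm]
    exact mul_le_mul_of_nonneg_left h6 (zero_le_one.trans (hP.one_le_seqHeight _))
  change _ ≤ 2 * (seqHeight P (i + 2) * _) at h4
  linarith

lemma eventually_abs_crossSeq_fst_le (hP : IsMinimalSeq ζ P) (hζ : IsExtremal ζ) :
    ∀ᶠ i in atTop, |((crossSeq P i).1 : ℝ)| ≤ seqHeight P (i + 1) ^ (1.6185 : ℝ) := by
  obtain ⟨M, hM⟩ := eventually_atTop.mp (hP.eventually_rpow_le_seqHeight hζ)
  have hbd : ∀ i ≥ M, |((crossSeq P i).1 : ℝ)| ≤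
      max 2 |((crossSeq P M).1 : ℝ)| * seqHeight P (i + 1) ^ (1.6184 : ℝ) := by
    intro i hi
    induction i, hi using Nat.le_induction with
    | base =>
      exact (le_max_right _ _).trans (le_mul_of_one_le_right (by positivity)
        (Real.one_le_rpow (hP.one_le_seqHeight _) (by norm_num)))
    | succ i hi ih =>
      have h1 := hP.one_le_seqHeight (i + 1)
      have h2 := hP.one_le_seqHeight (i + 2)
      have h0 : 0 < seqHeight P (i + 1) := zero_lt_one.trans_le h1
      have h0' : 0 < seqHeight P (i + 2) := zero_lt_one.trans_le h2
      by_cases hdot : tripleDot (P (i + 2)) (crossSeq P i) = 0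
      · have h3 := hP.natAbs_tripleCross_fst_eq i hdot
        have h4 : |((crossSeq P (i + 1)).1 : ℝ)| = |((crossSeq P i).1 : ℝ)| := by
          rw [← Int.cast_abs, ← Int.cast_abs, Int.abs_eq_natAbs, Int.abs_eq_natAbs]
          exact_mod_cast h3
        rw [h4]
        refine ih.trans ?_
        have : seqHeight P (i + 1) ≤ seqHeight P (i + 1 + 1) :=
          (hP.strictMono_seqHeight (by omega)).le
        gcongr
      · have h3 := hM i hi hdot
        have h4 : seqHeight P (i + 1) ≤ seqHeight P (i + 2) ^ (0.6184 : ℝ) := by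
          calc seqHeight P (i + 1) = (seqHeight P (i + 1) ^ (1.6175 : ℝ)) ^ (1 / 1.6175 : ℝ) := by
                rw [← Real.rpow_mul h0.le]; norm_num
            _ ≤ seqHeight P (i + 2) ^ (1 / 1.6175 : ℝ) := by gcongr
            _ ≤ _ := Real.rpow_le_rpow_of_exponent_le h2 (by norm_num)
        calc |((crossSeq P (i + 1)).1 : ℝ)|
            ≤ 2 * (seqHeight P (i + 1) * seqHeight P (i + 2)) := abs_crossSeq_fst_le P (i + 1)
          _ ≤ max 2 |((crossSeq P M).1 : ℝ)| *
              (seqHeight P (i + 2) ^ (0.6184 : ℝ) * seqHeight P (i + 2) ^ (1 : ℝ)) := by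
            rw [Real.rpow_one]
            gcongr
            exact le_max_left _ _
          _ = _ := by rw [← Real.rpow_add h0']; norm_num
  filter_upwards [eventually_ge_atTop M, hP.eventually_succ (max 2 |((crossSeq P M).1 : ℝ)|)
    (ε := 0.0001) (by norm_num)] with i hi h
  refine (hbd i hi).trans ?_
  have h0 : 0 < seqHeight P (i + 1) := zero_lt_one.trans_le (hP.one_le_seqHeight _)
  calc _ ≤ seqHeight P (i + 1) ^ (0.0001 : ℝ) * seqHeight P (i + 1) ^ (1.6184 : ℝ) := by gcongr
    _ = _ := by rw [← Real.rpow_add h0]; norm_num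

lemma exists_tripleDot_ne_zero (hP : IsMinimalSeq ζ P) (hζ : IsExtremal ζ) :
    ∀ᶠ T : ℝ in atTop, ∃ j, tripleDot (P (j + 2)) (crossSeq P j) ≠ 0 ∧
      T < seqHeight P (j + 1) ∧ seqHeight P (j + 1) ≤ T ^ (1.626 : ℝ) := by
  obtain ⟨M, hM⟩ := eventually_atTop.mp ((hP.eventually_le_abs_crossSeq_fst hζ).and
    ((hP.eventually_abs_crossSeq_fst_le hζ).and (hP.eventually_seqHeight_succ_le hζ)))
  filter_upwards [eventually_ge_atTop (seqHeight P M)] with T hT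
  classical
  have hex : ∃ n, T < seqHeight P n := (hP.tendsto_seqHeight.eventually_gt_atTop T).exists
  obtain ⟨i, hi⟩ : ∃ i, Nat.find hex = i + 1 := by
    refine Nat.exists_eq_succ_of_ne_zero fun h => ?_
    have := Nat.find_spec hex
    rw [h] at this
    exact absurd (hT.trans_lt this) (not_lt.mpr (hP.strictMono_seqHeight.monotone (Nat.zero_le _)))
  have hTi : T < seqHeight P (i + 1) := hi ▸ Nat.find_spec hex
  have hiT : seqHeight P i ≤ T := not_lt.mp (Nat.find_min hex (by omega))
  have hMi : M ≤ i := by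
    have := hP.strictMono_seqHeight.lt_iff_lt.mp (hT.trans_lt hTi)
    omega
  have hconst : ∀ m ≥ i, (∀ n, i ≤ n → n < m → tripleDot (P (n + 2)) (crossSeq P n) = 0) →
      |((crossSeq P m).1 : ℝ)| = |((crossSeq P i).1 : ℝ)| := by
    intro m hm
    induction m, hm using Nat.le_induction with
    | base => intro _; rfl
    | succ m hm ih =>
      intro h
      rw [← ih fun n h1 h2 => h n h1 (by omega)]
      have h3 := hP.natAbs_tripleCross_fst_eq m (h m hm (by omega))
      rw [← Int.cast_abs, ← Int.cast_abs, Int.abs_eq_natAbs, Int.abs_eq_natAbs]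
      exact_mod_cast h3
  have hgood : ∃ m, i ≤ m ∧ tripleDot (P (m + 2)) (crossSeq P m) ≠ 0 := by
    by_contra! hcon
    obtain ⟨m, hm, him⟩ := ((hP.eventually_succ (|((crossSeq P i).1 : ℝ)| + 1)
      (ε := 1.6175) (by norm_num)).and (eventually_ge_atTop i)).exists
    have h1 := hconst m him fun n hn _ => hcon n hn
    have h2 := (hM m (hMi.trans him)).1
    linarith
  obtain ⟨him, hm⟩ := Nat.find_spec hgood
  set m := Nat.find hgood
  have heq := hconst m him fun n h1 h2 => by
    by_contra h
    exact Nat.find_min hgood h2 ⟨h1, h⟩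
  refine ⟨m, hm, hTi.trans_le (hP.strictMono_seqHeight.monotone (by omega)), ?_⟩
  have hT1 : 1 ≤ T := (hP.one_le_seqHeight i).trans hiT
  have h0 : 0 ≤ seqHeight P (m + 1) := zero_le_one.trans (hP.one_le_seqHeight _)
  have h0' : 0 ≤ seqHeight P i := zero_le_one.trans (hP.one_le_seqHeight _)
  have h0'' : 0 ≤ seqHeight P (i + 1) := zero_le_one.trans (hP.one_le_seqHeight _)
  have h1 : seqHeight P (m + 1) ^ (1.6175 : ℝ) ≤ ((T ^ (1.62 : ℝ)) ^ (1.6185 : ℝ)) := by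
    refine (hM m (hMi.trans him)).1.trans ?_
    rw [heq]
    refine (hM i hMi).2.1.trans ?_
    have h2 := (hM i hMi).2.2
    have h3 : seqHeight P i ^ (1.62 : ℝ) ≤ T ^ (1.62 : ℝ) := by gcongr
    exact Real.rpow_le_rpow h0'' (h2.trans h3) (by norm_num)
  calc seqHeight P (m + 1) = (seqHeight P (m + 1) ^ (1.6175 : ℝ)) ^ (1 / 1.6175 : ℝ) := by
        rw [← Real.rpow_mul h0]; norm_num
    _ ≤ ((T ^ (1.62 : ℝ)) ^ (1.6185 : ℝ)) ^ (1 / 1.6175 : ℝ) := by gcongr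
    _ = T ^ (1.62 * 1.6185 * (1 / 1.6175) : ℝ) := by
        rw [← Real.rpow_mul (zero_le_one.trans hT1), ← Real.rpow_mul (zero_le_one.trans hT1)]
    _ ≤ _ := Real.rpow_le_rpow_of_exponent_le hT1 (by norm_num)

end IsMinimalSeq

section QuarticApproximation

variable {ζ H a p q a' p' q' D D' t z R Q : ℝ}

lemma abs_quarticErr_le (hH : 1 ≤ H) (h2 : 2 ≤ H ^ (0.00001 : ℝ))
    (hζ : |2 * ζ| ≤ H ^ (0.00001 : ℝ)) (hζ2 : |2 * ζ ^ 2| ≤ H ^ (0.00001 : ℝ))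
    (ha : |a| ≤ H ^ (1.6185 : ℝ)) (hp : |p| ≤ H ^ (-1.6176 : ℝ)) (hq : |q| ≤ H ^ (-1.6176 : ℝ))
    (ha' : |a'| ≤ H ^ (2.622 : ℝ)) (hp' : |p'| ≤ H ^ (-2.6164 : ℝ))
    (hq' : |q'| ≤ H ^ (-2.6164 : ℝ))
    (hD : D = a * (2 * ζ * p - q) - p * p) (hD' : D' = a' * (2 * ζ * p' - q') - p' * p')
    (ht : t = a * (2 * ζ * p' - q') + a' * (2 * ζ * p - q) - (p * p' + p * p'))
    (hz : z = t * a - D * a') (hR : R = t * p - D * p') (hQ : Q = t * q - D * q')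
    (hD1 : 1 ≤ |D|) :
    |D * D'| ≤ H ^ (0.007 : ℝ) ∧ |z| ≤ H ^ (0.621 : ℝ) ∧
      |D * D' * (a * p) - z * R| ≤ H ^ (-1.2 : ℝ) ∧
      |D * D' * (a * q) - z * Q| ≤ H ^ (-1.2 : ℝ) ∧
      |D * D' * (a * ζ * q + a * ζ ^ 2 * p - p * q) - (z * ζ * Q + z * ζ ^ 2 * R - R * Q)| ≤
        H ^ (-1.2 : ℝ) ∧
      |D * D' * (2 * a * ζ ^ 2 * q - q * q) - (2 * z * ζ ^ 2 * Q - Q * Q)| ≤ H ^ (-1.2 : ℝ) := by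
  have hu : |2 * ζ * p - q| ≤ H ^ (-1.61758 : ℝ) :=
    abs_sub_le_rpow hH h2 (abs_mul_le_rpow hH hζ hp le_rfl) hq (by norm_num) (by norm_num)
  have hu' : |2 * ζ * p' - q'| ≤ H ^ (-2.61638 : ℝ) :=
    abs_sub_le_rpow hH h2 (abs_mul_le_rpow hH hζ hp' le_rfl) hq' (by norm_num) (by norm_num)
  have hpp := abs_mul_le_rpow hH hp hp le_rfl
  have hpp' := abs_mul_le_rpow hH hp hp' le_rfl
  have bD : |D| ≤ H ^ (0.001 : ℝ) := by
    rw [hD]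
    exact abs_sub_le_rpow hH h2 (abs_mul_le_rpow hH ha hu le_rfl) hpp (by norm_num) (by norm_num)
  have bD' : |D'| ≤ H ^ (0.006 : ℝ) := by
    rw [hD']
    exact abs_sub_le_rpow hH h2 (abs_mul_le_rpow hH ha' hu' le_rfl)
      (abs_mul_le_rpow hH hp' hp' le_rfl) (by norm_num) (by norm_num)
  have b2pp : |p * p' + p * p'| ≤ H ^ (-4 : ℝ) :=
    abs_add_le_rpow hH h2 hpp' hpp' (by norm_num) (by norm_num)
  have bt : |t| ≤ H ^ (1.005 : ℝ) := by
    rw [ht]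
    exact abs_sub_le_rpow hH h2 (abs_add_le_rpow (c := 1.00444) hH h2
      (abs_mul_le_rpow hH ha hu' le_rfl) (abs_mul_le_rpow hH ha' hu le_rfl)
      (by norm_num) (by norm_num)) b2pp (by norm_num) (by norm_num)
  have bz : |z| ≤ H ^ (0.621 : ℝ) := by
    have : z = a * a * (2 * ζ * p' - q') - (a * (p * p' + p * p') - p * p * a') := by
      rw [hz, ht, hD]; ring
    rw [this]
    exact abs_sub_le_rpow hH h2
      (abs_mul_le_rpow hH (abs_mul_le_rpow hH ha ha le_rfl) hu' le_rfl)
      (abs_sub_le_rpow (c := 0) hH h2 (abs_mul_le_rpow hH ha b2pp le_rfl)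
        (abs_mul_le_rpow hH hpp ha' le_rfl) (by norm_num) (by norm_num))
      (by norm_num) (by norm_num)
  have bR : |R| ≤ H ^ (-0.6125 : ℝ) := by
    rw [hR]
    exact abs_sub_le_rpow hH h2 (abs_mul_le_rpow hH bt hp le_rfl)
      (abs_mul_le_rpow hH bD hp' le_rfl) (by norm_num) (by norm_num)
  have bQ : |Q| ≤ H ^ (-0.6125 : ℝ) := by
    rw [hQ]
    exact abs_sub_le_rpow hH h2 (abs_mul_le_rpow hH bt hq le_rfl)
      (abs_mul_le_rpow hH bD hq' le_rfl) (by norm_num) (by norm_num)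
  have bDD' : |D * D'| ≤ H ^ (0.007 : ℝ) := abs_mul_le_rpow hH bD bD' (by norm_num)
  have bRR := abs_mul_le_rpow hH bR bR le_rfl
  have bcross : |D * (a * z) * (p * q' - q * p')| ≤ H ^ (-1.9 : ℝ) :=
    abs_mul_le_rpow hH (abs_mul_le_rpow hH bD (abs_mul_le_rpow hH ha bz le_rfl) le_rfl)
      (abs_sub_le_rpow (c := -4.23) hH h2 (abs_mul_le_rpow hH hp hq' le_rfl)
        (abs_mul_le_rpow hH hq hp' le_rfl) (by norm_num) (by norm_num)) (by norm_num)
  have bone : ∀ {e : ℝ}, |D * e| ≤ H ^ (-1.224 : ℝ) → |e| ≤ H ^ (-1.224 : ℝ) := fun h =>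
    le_trans (by rw [abs_mul]; exact le_mul_of_one_le_left (abs_nonneg _) hD1) h
  have be1 : |D * D' * (a * p) - z * R| ≤ H ^ (-1.224 : ℝ) := by
    have : D * (D * D' * (a * p) - z * R) = D * (a * z) * (p * q' - q * p') -
        (R * R * (a * p) - p * p * (z * R)) := by
      rw [hR, hz, ht, hD, hD']; ring
    refine bone ?_
    rw [this]
    exact abs_sub_le_rpow hH h2 bcross (abs_sub_le_rpow (c := -1.22405) hH h2
      (abs_mul_le_rpow hH bRR (abs_mul_le_rpow hH ha hp le_rfl) le_rfl)
      (abs_mul_le_rpow hH hpp (abs_mul_le_rpow hH bz bR le_rfl) le_rfl)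
      (by norm_num) (by norm_num)) (by norm_num) (by norm_num)
  have be2 : |D * D' * (a * q) - z * Q| ≤ H ^ (-1.224 : ℝ) := by
    have : D * (D * D' * (a * q) - z * Q) = 2 * ζ * (D * (a * z) * (p * q' - q * p')) -
        (R * R * (a * q) - p * p * (z * Q)) := by
      rw [hQ, hR, hz, ht, hD, hD']; ring
    refine bone ?_
    rw [this]
    exact abs_sub_le_rpow hH h2 (abs_mul_le_rpow hH hζ bcross le_rfl)
      (abs_sub_le_rpow (c := -1.22405) hH h2
      (abs_mul_le_rpow hH bRR (abs_mul_le_rpow hH ha hq le_rfl) le_rfl)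
      (abs_mul_le_rpow hH hpp (abs_mul_le_rpow hH bz bQ le_rfl) le_rfl)
      (by norm_num) (by norm_num)) (by norm_num) (by norm_num)
  have hmono : ∀ {e : ℝ}, |e| ≤ H ^ (-1.224 : ℝ) → |e| ≤ H ^ (-1.2 : ℝ) := fun h =>
    h.trans (Real.rpow_le_rpow_of_exponent_le hH (by norm_num))
  have hζ' : |ζ| ≤ H ^ (0.00001 : ℝ) := by
    rw [abs_mul, abs_two] at hζ
    linarith [abs_nonneg ζ]
  have hζ2' : |ζ ^ 2| ≤ H ^ (0.00001 : ℝ) := by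
    rw [abs_mul, abs_two] at hζ2
    linarith [abs_nonneg (ζ ^ 2)]
  refine ⟨bDD', bz, hmono be1, hmono be2, ?_, ?_⟩
  · have : D * D' * (a * ζ * q + a * ζ ^ 2 * p - p * q) -
        (z * ζ * Q + z * ζ ^ 2 * R - R * Q) =
        (ζ * (D * D' * (a * q) - z * Q) + ζ ^ 2 * (D * D' * (a * p) - z * R)) -
        (D * D' * (p * q) - R * Q) := by ring
    rw [this]
    exact abs_sub_le_rpow hH h2 (abs_add_le_rpow (c := -1.22) hH h2
      (abs_mul_le_rpow hH hζ' be2 le_rfl) (abs_mul_le_rpow hH hζ2' be1 le_rfl)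
      (by norm_num) (by norm_num)) (abs_sub_le_rpow (c := -1.22) hH h2
      (abs_mul_le_rpow hH bDD' (abs_mul_le_rpow hH hp hq le_rfl) le_rfl)
      (abs_mul_le_rpow hH bR bQ le_rfl) (by norm_num) (by norm_num)) (by norm_num) (by norm_num)
  · have : D * D' * (2 * a * ζ ^ 2 * q - q * q) - (2 * z * ζ ^ 2 * Q - Q * Q) =
        2 * ζ ^ 2 * (D * D' * (a * q) - z * Q) - (D * D' * (q * q) - Q * Q) := by ring
    rw [this]
    exact abs_sub_le_rpow hH h2 (abs_mul_le_rpow hH hζ2 be2 le_rfl)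
      (abs_sub_le_rpow (c := -1.22) hH h2
      (abs_mul_le_rpow hH bDD' (abs_mul_le_rpow hH hq hq le_rfl) le_rfl)
      (abs_mul_le_rpow hH bQ bQ le_rfl) (by norm_num) (by norm_num)) (by norm_num) (by norm_num)

end QuarticApproximation

lemma exists_quartic_approx {ζ H : ℝ} {x x' : ℤ × ℤ × ℤ} (hH : 1 ≤ H)
    (h2 : 2 ≤ H ^ (0.00001 : ℝ))
    (hζ : |2 * ζ| ≤ H ^ (0.00001 : ℝ)) (hζ2 : |2 * ζ ^ 2| ≤ H ^ (0.00001 : ℝ))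
    (hx : |(x.1 : ℝ)| ≤ H ^ (1.6185 : ℝ)) (hxl : H ^ (1.6175 : ℝ) ≤ |(x.1 : ℝ)|)
    (hp : |linErr ζ x| ≤ H ^ (-1.6176 : ℝ)) (hq : |quadErr ζ x| ≤ H ^ (-1.6176 : ℝ))
    (hx' : |(x'.1 : ℝ)| ≤ H ^ (2.622 : ℝ)) (hp' : |linErr ζ x'| ≤ H ^ (-2.6164 : ℝ))
    (hq' : |quadErr ζ x'| ≤ H ^ (-2.6164 : ℝ)) (hD : tripleDisc x ≠ 0) (hD' : tripleDisc x' ≠ 0) :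
    ∃ n : ℕ, H ^ (3.23 : ℝ) ≤ n ∧ (n : ℝ) ≤ H ^ (3.245 : ℝ) ∧
      ∀ j : ℕ, 1 ≤ j → j ≤ 4 → ∃ y : ℤ, |(n : ℝ) * ζ ^ j - y| ≤ H ^ (-1.2 : ℝ) := by
  obtain ⟨a, b, c⟩ := x
  obtain ⟨a', b', c'⟩ := x'
  let D : ℤ := tripleDisc (a, b, c)
  let D' : ℤ := tripleDisc (a', b', c')
  let t : ℤ := a * c' + c * a' - 2 * b * b'
  let z₀ : ℤ := t * a - D * a'
  let z₁ : ℤ := t * b - D * b'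
  let z₂ : ℤ := t * c - D * c'
  have hDR : (1 : ℝ) ≤ |(D : ℝ)| := by exact_mod_cast Int.one_le_abs hD
  have hDR' : (1 : ℝ) ≤ |(D' : ℝ)| := by exact_mod_cast Int.one_le_abs hD'
  obtain ⟨bDD, bz, b1, b2, b3, b4⟩ := abs_quarticErr_le (D := D) (D' := D') (t := t) (z := z₀)
    (R := z₀ * ζ - z₁) (Q := z₀ * ζ ^ 2 - z₂) hH h2 hζ hζ2 hx hp hq hx' hp' hq'
    (cast_tripleDisc ζ _) (cast_tripleDisc ζ _)
    (by simp only [t, linErr, quadErr]; push_cast; ring)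
    (by simp only [z₀]; push_cast; ring)
    (by simp only [z₀, z₁, linErr]; push_cast; ring)
    (by simp only [z₀, z₂, quadErr]; push_cast; ring) hDR
  let w : ℤ := D * D' * (a * a) - z₀ * z₀
  have hz : |(z₀ : ℝ) * z₀| ≤ H ^ (1.242 : ℝ) := abs_mul_le_rpow hH bz bz (by norm_num)
  have hw : (w : ℝ) = D * D' * (a * a) - z₀ * z₀ := by simp only [w]; push_cast; ring
  have hwu : |(w : ℝ)| ≤ H ^ (3.245 : ℝ) := by
    rw [hw]
    exact abs_sub_le_rpow hH h2 (abs_mul_le_rpow hH bDD (abs_mul_le_rpow hH hx hx le_rfl) le_rfl)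
      hz (by norm_num) (by norm_num)
  have hwl : H ^ (3.23 : ℝ) ≤ |(w : ℝ)| := by
    have h0 : 0 < H := zero_lt_one.trans_le hH
    have h3 : H ^ (3.235 : ℝ) ≤ |(D : ℝ) * D' * (a * a)| := by
      rw [abs_mul, abs_mul, abs_mul]
      refine le_trans ?_ (le_mul_of_one_le_left (by positivity)
        (one_le_mul_of_one_le_of_one_le hDR hDR'))
      calc H ^ (3.235 : ℝ) = H ^ (1.6175 : ℝ) * H ^ (1.6175 : ℝ) := by
            rw [← Real.rpow_add h0]; norm_num
        _ ≤ _ := mul_le_mul hxl hxl (by positivity) (abs_nonneg _)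
    have h4 : 2 * H ^ (3.23 : ℝ) ≤ H ^ (3.235 : ℝ) := by
      calc _ ≤ H ^ (0.00001 : ℝ) * H ^ (3.23 : ℝ) := by gcongr
        _ = H ^ (0.00001 + 3.23 : ℝ) := by rw [← Real.rpow_add h0]
        _ ≤ _ := Real.rpow_le_rpow_of_exponent_le hH (by norm_num)
    have h5 : H ^ (1.242 : ℝ) ≤ H ^ (3.23 : ℝ) :=
      Real.rpow_le_rpow_of_exponent_le hH (by norm_num)
    rw [hw]
    linarith [abs_sub_abs_le_abs_sub ((D : ℝ) * D' * (a * a)) (z₀ * z₀)]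
  have hcast : (w.natAbs : ℝ) = |(w : ℝ)| := by rw [Nat.cast_natAbs, Int.cast_abs]
  refine ⟨w.natAbs, hcast ▸ hwl, hcast ▸ hwu, fun j hj1 hj4 => ?_⟩
  have key : ∃ y : ℤ, |(w : ℝ) * ζ ^ j - y| ≤ H ^ (-1.2 : ℝ) := by
    interval_cases j
    · refine ⟨D * D' * (a * b) - z₀ * z₁, b1.trans_eq' (congrArg _ ?_)⟩
      rw [hw]; simp only [linErr]; push_cast; ring
    · refine ⟨D * D' * (a * c) - z₀ * z₂, b2.trans_eq' (congrArg _ ?_)⟩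
      rw [hw]; simp only [quadErr]; push_cast; ring
    · refine ⟨D * D' * (b * c) - z₁ * z₂, b3.trans_eq' (congrArg _ ?_)⟩
      rw [hw]; simp only [linErr, quadErr]; push_cast; ring
    · refine ⟨D * D' * (c * c) - z₂ * z₂, b4.trans_eq' (congrArg _ ?_)⟩
      rw [hw]; simp only [quadErr]; push_cast; ring
  obtain ⟨y, hy⟩ := key
  rw [hcast]
  rcases abs_choice (w : ℝ) with h | h
  · exact ⟨y, by rwa [h]⟩
  · refine ⟨-y, hy.trans_eq' ?_⟩
    rw [h, ← abs_neg]; push_cast; ring_nf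

lemma exists_quartic_approx_of_isExtremal {ζ : ℝ} (hζ : IsExtremal ζ) :
    ∀ᶠ T : ℝ in Filter.atTop, ∃ H : ℝ, T < H ∧ H ≤ T ^ (1.626 : ℝ) ∧ ∃ n : ℕ,
      H ^ (3.23 : ℝ) ≤ n ∧ (n : ℝ) ≤ H ^ (3.245 : ℝ) ∧
      ∀ j : ℕ, 1 ≤ j → j ≤ 4 → ∃ y : ℤ, |(n : ℝ) * ζ ^ j - y| ≤ H ^ (-1.2 : ℝ) := by
  obtain ⟨P, hP⟩ : ∃ P, IsMinimalSeq ζ P := by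
    refine exists_isMinimalSeq (fun ε hε => ?_) fun v => quadEval_ne_zero hζ.1
    obtain ⟨X₀, hX⟩ := exists_quadEval_le_of_isExtremal hζ
    obtain ⟨X, hXX, hXε⟩ := ((Filter.eventually_ge_atTop X₀).and
      ((tendsto_rpow_neg_atTop (show (0 : ℝ) < 26178 / 10000 by norm_num)).eventually_lt_const
        hε)).exists
    obtain ⟨v, -, hv0, hv⟩ := hX X hXX
    exact ⟨v, by rintro rfl; simp [quadEval] at hv0, hv.trans_lt hXε⟩
  have hsucc := Filter.tendsto_add_atTop_nat 1
  obtain ⟨M, hM⟩ := Filter.eventually_atTop.mp ((hP.eventually_abs_err_le hζ).and <|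
    (hP.eventually_le_abs_crossSeq_fst hζ).and <| (hP.eventually_abs_crossSeq_fst_le hζ).and <|
    (hP.eventually_tripleDisc_ne_zero hζ).and <| (hP.eventually_rpow_le_seqHeight hζ).and <|
    (hsucc.eventually (hP.eventually_seqHeight_succ_le hζ)).and <|
    (hP.eventually_succ 2 (ε := 0.00001) (by norm_num)).and <|
    (hP.eventually_succ |2 * ζ| (ε := 0.00001) (by norm_num)).and
    (hP.eventually_succ |2 * ζ ^ 2| (ε := 0.00001) (by norm_num)))
  filter_upwards [hP.exists_tripleDot_ne_zero hζ,
    Filter.eventually_ge_atTop (seqHeight P (M + 1))] with T ⟨j, hj, hTj, hjT⟩ hMT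
  have hMj : M ≤ j := by
    have := hP.strictMono_seqHeight.lt_iff_lt.mp (hMT.trans_lt hTj)
    omega
  refine ⟨seqHeight P (j + 1), hTj, hjT, ?_⟩
  obtain ⟨⟨hp, hq⟩, hxl, hx, hD, hlow, hup, h2, hζ1, hζ2⟩ := hM j hMj
  obtain ⟨⟨hp', hq'⟩, -, hx', hD', -⟩ := hM (j + 1) (hMj.trans (Nat.le_succ j))
  replace hlow := hlow hj
  have hH := hP.one_le_seqHeight (j + 1)
  have h0 : 0 < seqHeight P (j + 1) := zero_lt_one.trans_le hH
  have hsmall : seqHeight P (j + 1 + 1) ^ (-1.6176 : ℝ) ≤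
      seqHeight P (j + 1) ^ (-2.6164 : ℝ) := by
    calc _ ≤ (seqHeight P (j + 1) ^ (1.6175 : ℝ)) ^ (-1.6176 : ℝ) :=
          Real.rpow_le_rpow_of_nonpos (Real.rpow_pos_of_pos h0 _) hlow (by norm_num)
      _ = seqHeight P (j + 1) ^ (1.6175 * (-1.6176) : ℝ) := (Real.rpow_mul h0.le _ _).symm
      _ ≤ _ := Real.rpow_le_rpow_of_exponent_le hH (by norm_num)
  have hbig : seqHeight P (j + 1 + 1) ^ (1.6185 : ℝ) ≤ seqHeight P (j + 1) ^ (2.622 : ℝ) := by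
    calc _ ≤ (seqHeight P (j + 1) ^ (1.62 : ℝ)) ^ (1.6185 : ℝ) :=
          Real.rpow_le_rpow (zero_le_one.trans (hP.one_le_seqHeight _)) hup (by norm_num)
      _ = seqHeight P (j + 1) ^ (1.62 * 1.6185 : ℝ) := (Real.rpow_mul h0.le _ _).symm
      _ ≤ _ := Real.rpow_le_rpow_of_exponent_le hH (by norm_num)
  exact exists_quartic_approx hH h2 hζ1 hζ2 hx hxl hp hq (hx'.trans hbig) (hp'.trans hsmall)
    (hq'.trans hsmall) hD hD'

lemma exists_good_multiple {ζ H Y : ℝ} {n : ℕ} (hY : 0 < Y) (hH : 1 ≤ H) (h2 : 2 ≤ H ^ (0.01 : ℝ))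
    (hYH : Y ≤ H ^ (1 / 0.305 : ℝ)) (hn : H ^ (3.23 : ℝ) ≤ n) (hnY : n ≤ Y)
    (h : ∀ j : ℕ, 1 ≤ j → j ≤ 4 → ∃ y : ℤ, |(n : ℝ) * ζ ^ j - y| ≤ H ^ (-1.2 : ℝ)) :
    ∃ s : ℕ, Y < s ∧ s ≤ 2 * Y ∧
      ∀ j : ℕ, 1 ≤ j → j ≤ 4 → ∃ y : ℤ, |(s : ℝ) * ζ ^ j - y| ≤ (s : ℝ) ^ (-0.3091 : ℝ) := by
  have h0 : 0 < H := zero_lt_one.trans_le hH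
  have hn0 : (0 : ℝ) < n := (Real.rpow_pos_of_pos h0 _).trans_le hn
  set m : ℕ := ⌊Y / n⌋₊ + 1
  have hm1 : Y < m * n := by
    have := Nat.lt_floor_add_one (Y / n)
    rw [div_lt_iff₀ hn0] at this
    simpa [m] using this
  have hm2 : m * n ≤ 2 * Y := by
    have := (le_div_iff₀ hn0).mp (Nat.floor_le (div_nonneg hY.le hn0.le))
    simp only [m]; push_cast
    linarith
  have h2Y : 2 * Y ≤ H ^ (3.29 : ℝ) := by
    calc 2 * Y ≤ H ^ (0.01 : ℝ) * H ^ (1 / 0.305 : ℝ) := by gcongr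
      _ = H ^ (0.01 + 1 / 0.305 : ℝ) := (Real.rpow_add h0 _ _).symm
      _ ≤ _ := Real.rpow_le_rpow_of_exponent_le hH (by norm_num)
  have hm : (m : ℝ) ≤ H ^ (0.06 : ℝ) := by
    refine le_of_mul_le_mul_right ?_ (Real.rpow_pos_of_pos h0 (3.23 : ℝ))
    rw [← Real.rpow_add h0]
    calc (m : ℝ) * H ^ (3.23 : ℝ) ≤ m * n := by gcongr
      _ ≤ H ^ (3.29 : ℝ) := hm2.trans h2Y
      _ = _ := by norm_num
  refine ⟨m * n, by exact_mod_cast hm1, by exact_mod_cast hm2, fun j hj1 hj4 => ?_⟩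
  obtain ⟨y, hy⟩ := h j hj1 hj4
  refine ⟨m * y, ?_⟩
  have e : ((m * n : ℕ) : ℝ) * ζ ^ j - ((m * y : ℤ) : ℝ) = m * ((n : ℝ) * ζ ^ j - y) := by
    push_cast; ring
  rw [e, abs_mul, Nat.abs_cast]
  have hs : ((m * n : ℕ) : ℝ) ≤ H ^ (3.29 : ℝ) := by
    push_cast; exact hm2.trans h2Y
  have hs0 : (0 : ℝ) < ((m * n : ℕ) : ℝ) := by
    push_cast; exact hY.trans hm1
  calc _ ≤ H ^ (0.06 : ℝ) * H ^ (-1.2 : ℝ) := by gcongr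
    _ = H ^ (0.06 + -1.2 : ℝ) := (Real.rpow_add h0 _ _).symm
    _ ≤ H ^ (3.29 * (-0.3091) : ℝ) := Real.rpow_le_rpow_of_exponent_le hH (by norm_num)
    _ = (H ^ (3.29 : ℝ)) ^ (-0.3091 : ℝ) := Real.rpow_mul h0.le _ _
    _ ≤ _ := Real.rpow_le_rpow_of_nonpos hs0 hs (by norm_num)

lemma exists_good_between {ζ : ℝ} (hζ : IsExtremal ζ) :
    ∀ᶠ Y : ℝ in Filter.atTop, ∃ s : ℕ, Y < s ∧ (s : ℝ) ≤ Y ^ (1.618 : ℝ) ∧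
      ∀ j : ℕ, 1 ≤ j → j ≤ 4 → ∃ y : ℤ, |(s : ℝ) * ζ ^ j - y| ≤ (s : ℝ) ^ (-0.3091 : ℝ) := by
  have hlim := tendsto_rpow_atTop (show (0 : ℝ) < 0.305 by norm_num)
  filter_upwards [hlim.eventually (exists_quartic_approx_of_isExtremal hζ),
    hlim.eventually ((tendsto_rpow_atTop (show (0 : ℝ) < 0.01 by norm_num)).eventually_ge_atTop 2),
    (tendsto_rpow_atTop (show (0 : ℝ) < 0.618 by norm_num)).eventually_ge_atTop 2,
    Filter.eventually_ge_atTop 1] with Y ⟨H, hTH, hHT, n, hn1, hn2, hn⟩ hT2 hY2 hY1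
  have hY0 : 0 < Y := zero_lt_one.trans_le hY1
  have hH : 1 ≤ H := (Real.one_le_rpow hY1 (by norm_num)).trans hTH.le
  have h0 : 0 < H := zero_lt_one.trans_le hH
  have hT0 : 0 < Y ^ (0.305 : ℝ) := Real.rpow_pos_of_pos hY0 _
  rcases lt_or_ge Y n with hYn | hnY
  · refine ⟨n, hYn, ?_, fun j hj1 hj4 => ?_⟩
    · calc (n : ℝ) ≤ H ^ (3.245 : ℝ) := hn2
        _ ≤ ((Y ^ (0.305 : ℝ)) ^ (1.626 : ℝ)) ^ (3.245 : ℝ) := by gcongr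
        _ = Y ^ (0.305 * 1.626 * 3.245 : ℝ) := by
            rw [← Real.rpow_mul hY0.le, ← Real.rpow_mul hY0.le]
        _ ≤ _ := Real.rpow_le_rpow_of_exponent_le hY1 (by norm_num)
    · obtain ⟨y, hy⟩ := hn j hj1 hj4
      refine ⟨y, hy.trans ?_⟩
      calc H ^ (-1.2 : ℝ) ≤ H ^ (3.245 * (-0.3091) : ℝ) :=
            Real.rpow_le_rpow_of_exponent_le hH (by norm_num)
        _ = (H ^ (3.245 : ℝ)) ^ (-0.3091 : ℝ) := Real.rpow_mul h0.le _ _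
        _ ≤ _ := Real.rpow_le_rpow_of_nonpos (hY0.trans hYn) hn2 (by norm_num)
  · have hYH : Y ≤ H ^ (1 / 0.305 : ℝ) := by
      calc Y = (Y ^ (0.305 : ℝ)) ^ (1 / 0.305 : ℝ) := by
            rw [← Real.rpow_mul hY0.le]; norm_num
        _ ≤ _ := by gcongr
    have h2 : 2 ≤ H ^ (0.01 : ℝ) := hT2.trans (by gcongr)
    obtain ⟨s, hs1, hs2, hs⟩ := exists_good_multiple hY0 hH h2 hYH hn1 hnY hn
    refine ⟨s, hs1, hs2.trans ?_, hs⟩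
    calc 2 * Y ≤ Y ^ (0.618 : ℝ) * Y ^ (1 : ℝ) := by rw [Real.rpow_one]; gcongr
      _ = _ := by rw [← Real.rpow_add hY0]; norm_num

theorem extremal_good_approx_sequence (ζ : ℝ) (hζ : IsExtremal ζ) :
    ∃ c : ℝ, 0 < c ∧ ∃ c' : ℝ, 0 < c' ∧ ∃ x : ℕ → ℕ, StrictMono x ∧
      (∀ k : ℕ, 0 < x k) ∧
      (∀ k : ℕ, ((x (k + 1) : ℝ)) ≤ c * (x k : ℝ) ^ ((1 + Real.sqrt 5) / 2)) ∧
      (∀ k : ℕ, ∀ j : ℕ, 1 ≤ j → j ≤ 4 →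
        |(x k : ℝ) * ζ ^ j - (round ((x k : ℝ) * ζ ^ j) : ℝ)| ≤
          c' * (x k : ℝ) ^ (-(Real.sqrt 5 - 1) / 4)) := by
  have h5 : Real.sqrt 5 < 2.2361 := by
    rw [Real.sqrt_lt' (by norm_num)]; norm_num
  have h5' : 2.236 < Real.sqrt 5 := by
    rw [Real.lt_sqrt (by norm_num)]; norm_num
  obtain ⟨Y, hY⟩ := Filter.eventually_atTop.mp (exists_good_between hζ)
  let S := {s : ℕ // max Y 1 < s ∧
    ∀ j : ℕ, 1 ≤ j → j ≤ 4 → ∃ y : ℤ, |(s : ℝ) * ζ ^ j - y| ≤ (s : ℝ) ^ (-0.3091 : ℝ)}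
  have step : ∀ s : S, ∃ s' : S, s.1 < s'.1 ∧ (s'.1 : ℝ) ≤ (s.1 : ℝ) ^ (1.618 : ℝ) := by
    rintro ⟨s, hs, -⟩
    obtain ⟨s', h1, h2, h3⟩ := hY s ((le_max_left _ _).trans hs.le)
    exact ⟨⟨s', hs.trans h1, h3⟩, Nat.cast_lt.mp h1, h2⟩
  obtain ⟨s₀, h1, -, h3⟩ := hY (max Y 1) (le_max_left _ _)
  choose f hf using step
  let x : ℕ → S := fun n => f^[n] ⟨s₀, h1, h3⟩
  have hx : ∀ n, x (n + 1) = f (x n) := fun n => Function.iterate_succ_apply' f n _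
  have hone : ∀ n, (1 : ℝ) ≤ (x n).1 := fun n => ((le_max_right _ _).trans_lt (x n).2.1).le
  refine ⟨1, one_pos, 1, one_pos, fun n => (x n).1, strictMono_nat_of_lt_succ fun n => ?_,
    fun n => ?_, fun n => ?_, fun n j hj1 hj4 => ?_⟩
  · rw [hx]; exact (hf _).1
  · exact Nat.cast_pos.mp (zero_lt_one.trans_le (hone n))
  · beta_reduce
    rw [hx, one_mul]
    exact (hf _).2.trans (Real.rpow_le_rpow_of_exponent_le (hone n) (by linarith))
  · obtain ⟨y, hy⟩ := (x n).2.2 j hj1 hj4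
    rw [one_mul]
    exact (round_le _ y).trans (hy.trans
      (Real.rpow_le_rpow_of_exponent_le (hone n) (by linarith)))
end

section
/- For every C₀ > 0 there exist constants C₁ > 0 and H₀ > 0 with the following property. Let ζ be a real number, let P, Q ∈ ℤ[T] with P(ζ) ≠ 0 and Q(ζ) ≠ 0, set R = P·Q and assume R has degree at most three, H(P) ≥ H₀ and H(Q) ≥ H₀. Let δ ∈ ℝ with |δ| ≤ 1/2 be defined by |Q(ζ)| = H(Q)^{−1+δ}, and assume 1/log H(Q) ≤ C₀·|δ|. Define q₁ = (3/4)(log H(P) − log|P(ζ)|), ℓ₁ = (3/4)log H(P) + (1/4)log|P(ζ)|, q₂ = (3/4)(log H(R) − log|R(ζ)|) and ℓ₂ = (3/4)log H(R) + (1/4)log|R(ζ)|. Then q₂ ≠ q₁ and |(ℓ₂ − ℓ₁)/(q₂ − q₁) − 1/3| ≤ C₁·|δ|. -/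
open Polynomial

theorem polyH_eq_supNorm (P : Polynomial ℤ) :
    polyH P = (P.map (Int.castRingHom ℂ)).supNorm := by
  have hcoeff (i : ℕ) : ‖(P.map (Int.castRingHom ℂ)).coeff i‖ = ((P.coeff i).natAbs : ℝ) := by
    simp [Nat.cast_natAbs]
  apply le_antisymm
  · unfold polyH
    rcases P.support.eq_empty_or_nonempty with h | h
    · simp [h, supNorm_nonneg]
    · obtain ⟨i, -, hi⟩ := Finset.exists_mem_eq_sup _ h fun i => (P.coeff i).natAbs
      rw [hi, ← hcoeff]
      exact le_supNorm _ i
  · obtain ⟨i, hi⟩ := (P.map (Int.castRingHom ℂ)).exists_eq_supNorm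
    rw [hi, hcoeff, polyH, Nat.cast_le]
    by_cases h : i ∈ P.support
    · exact Finset.le_sup (f := fun i => (P.coeff i).natAbs) h
    · simp [notMem_support_iff.mp h]

theorem polyH_le_two_pow_mul_mahlerMeasure {n : ℕ} {P : Polynomial ℤ} (hP : P.natDegree ≤ n) :
    polyH P ≤ 2 ^ n * (P.map (Int.castRingHom ℂ)).mahlerMeasure := by
  rw [polyH_eq_supNorm]
  refine (supNorm_le_choose_natDegree_div_two_mul_mahlerMeasure _).trans ?_
  gcongr
  · exact mahlerMeasure_nonneg _
  · exact_mod_cast (Nat.choose_le_two_pow _ _).trans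
      (Nat.pow_le_pow_right two_pos (natDegree_map_le.trans hP))

theorem mahlerMeasure_le_mul_polyH {n : ℕ} {P : Polynomial ℤ} (hP : P.natDegree ≤ n) :
    (P.map (Int.castRingHom ℂ)).mahlerMeasure ≤ (n + 1) * polyH P := by
  rw [polyH_eq_supNorm]
  refine (mahlerMeasure_le_sqrt_natDegree_add_one_mul_supNorm _).trans ?_
  gcongr
  · exact supNorm_nonneg _
  · rw [Real.sqrt_le_left (by positivity)]
    have h : ((P.map (Int.castRingHom ℂ)).natDegree : ℝ) ≤ n :=
      Nat.cast_le.mpr (natDegree_map_le.trans hP)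
    nlinarith [Nat.cast_nonneg (α := ℝ) n]

/-- Gelfond's inequality, in logarithmic form: the logarithmic height is additive on products
up to an error depending only on the degree. -/
theorem abs_log_polyH_mul_sub_le {n : ℕ} {P Q : Polynomial ℤ} (hn : (P * Q).natDegree ≤ n)
    (hP : 0 < polyH P) (hQ : 0 < polyH Q) :
    |Real.log (polyH (P * Q)) - Real.log (polyH P) - Real.log (polyH Q)| ≤
      Real.log (4 ^ n * (n + 1) ^ 2) := by
  have hP0 : P ≠ 0 := by rintro rfl; simp [polyH] at hP
  have hQ0 : Q ≠ 0 := by rintro rfl; simp [polyH] at hQ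
  rw [natDegree_mul hP0 hQ0] at hn
  have hPn : P.natDegree ≤ n := by omega
  have hQn : Q.natDegree ≤ n := by omega
  have hRn : (P * Q).natDegree ≤ n := by rwa [natDegree_mul hP0 hQ0]
  have hmul : ((P * Q).map (Int.castRingHom ℂ)).mahlerMeasure =
      (P.map (Int.castRingHom ℂ)).mahlerMeasure * (Q.map (Int.castRingHom ℂ)).mahlerMeasure := by
    rw [Polynomial.map_mul, mahlerMeasure_mul]
  have hpow : (2 : ℝ) ^ n * 2 ^ n = 4 ^ n := by rw [← mul_pow]; norm_num
  have hpow_le : (2 : ℝ) ^ n ≤ 4 ^ n := by gcongr; norm_num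
  have hn0 : (0 : ℝ) ≤ n := n.cast_nonneg
  have lower : polyH P * polyH Q ≤ 4 ^ n * (n + 1) ^ 2 * polyH (P * Q) := by
    have hR : 0 ≤ polyH (P * Q) := Nat.cast_nonneg _
    calc polyH P * polyH Q
        ≤ (2 ^ n * (P.map (Int.castRingHom ℂ)).mahlerMeasure) *
          (2 ^ n * (Q.map (Int.castRingHom ℂ)).mahlerMeasure) :=
          mul_le_mul (polyH_le_two_pow_mul_mahlerMeasure hPn)
            (polyH_le_two_pow_mul_mahlerMeasure hQn) hQ.le
            (mul_nonneg (by positivity) (mahlerMeasure_nonneg _))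
      _ = 4 ^ n * ((P * Q).map (Int.castRingHom ℂ)).mahlerMeasure := by
          rw [hmul, ← hpow]; ring
      _ ≤ 4 ^ n * ((n + 1) * polyH (P * Q)) := by
          gcongr; exact mahlerMeasure_le_mul_polyH hRn
      _ = 4 ^ n * (n + 1) * polyH (P * Q) := by ring
      _ ≤ 4 ^ n * (n + 1) ^ 2 * polyH (P * Q) := by gcongr; nlinarith
  have upper : polyH (P * Q) ≤ 4 ^ n * (n + 1) ^ 2 * (polyH P * polyH Q) := by
    calc polyH (P * Q)
        ≤ 2 ^ n * ((P.map (Int.castRingHom ℂ)).mahlerMeasure *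
            (Q.map (Int.castRingHom ℂ)).mahlerMeasure) :=
          hmul ▸ polyH_le_two_pow_mul_mahlerMeasure hRn
      _ ≤ 2 ^ n * (((n + 1) * polyH P) * ((n + 1) * polyH Q)) := by
          refine mul_le_mul_of_nonneg_left ?_ (by positivity)
          exact mul_le_mul (mahlerMeasure_le_mul_polyH hPn) (mahlerMeasure_le_mul_polyH hQn)
            (mahlerMeasure_nonneg _) (by positivity)
      _ = 2 ^ n * (n + 1) ^ 2 * (polyH P * polyH Q) := by ring
      _ ≤ 4 ^ n * (n + 1) ^ 2 * (polyH P * polyH Q) := by gcongr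
  have hK : (0 : ℝ) < 4 ^ n * (n + 1) ^ 2 := by positivity
  have hPQ : 0 < polyH P * polyH Q := mul_pos hP hQ
  have hR : 0 < polyH (P * Q) := pos_of_mul_pos_right (hPQ.trans_le lower) hK.le
  have h₁ := Real.log_le_log hPQ lower
  have h₂ := Real.log_le_log hR upper
  rw [Real.log_mul hP.ne' hQ.ne', Real.log_mul hK.ne' hR.ne'] at h₁
  rw [Real.log_mul hK.ne' hPQ.ne', Real.log_mul hP.ne' hQ.ne'] at h₂
  rw [abs_le]
  constructor <;> linarith

theorem schmidt_summerer_slope (C₀ : ℝ) (hC₀ : 0 < C₀) :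
    ∃ C₁ : ℝ, 0 < C₁ ∧ ∃ H₀ : ℝ, 0 < H₀ ∧
      ∀ (ζ : ℝ) (P Q : Polynomial ℤ), pev ζ P ≠ 0 → pev ζ Q ≠ 0 →
        (P * Q).natDegree ≤ 3 → H₀ ≤ polyH P → H₀ ≤ polyH Q →
        ∀ δ : ℝ, |δ| ≤ 1 / 2 → |pev ζ Q| = polyH Q ^ (-1 + δ) →
          1 / Real.log (polyH Q) ≤ C₀ * |δ| →
          (3 / 4 : ℝ) * (Real.log (polyH (P * Q)) - Real.log |pev ζ (P * Q)|) ≠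
            (3 / 4 : ℝ) * (Real.log (polyH P) - Real.log |pev ζ P|) ∧
          |((3 / 4 : ℝ) * Real.log (polyH (P * Q)) + (1 / 4 : ℝ) * Real.log |pev ζ (P * Q)| -
              ((3 / 4 : ℝ) * Real.log (polyH P) + (1 / 4 : ℝ) * Real.log |pev ζ P|)) /
            ((3 / 4 : ℝ) * (Real.log (polyH (P * Q)) - Real.log |pev ζ (P * Q)|) -
              (3 / 4 : ℝ) * (Real.log (polyH P) - Real.log |pev ζ P|)) - 1 / 3|
            ≤ C₁ * |δ| := by
  set c : ℝ := Real.log (4 ^ 3 * ((3 : ℕ) + 1) ^ 2) with hc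
  have hc0 : 0 ≤ c := Real.log_nonneg (by norm_num)
  refine ⟨1 + c * C₀, by positivity, Real.exp (2 * c + 1), Real.exp_pos _, ?_⟩
  intro ζ P Q hP hQ hdeg hHP hHQ δ hδ hQδ hQC
  have hP0 : 0 < polyH P := (Real.exp_pos _).trans_le hHP
  have hQ0 : 0 < polyH Q := (Real.exp_pos _).trans_le hHQ
  have hE := abs_log_polyH_mul_sub_le hdeg hP0 hQ0
  rw [← hc] at hE
  have hh : 2 * c + 1 ≤ Real.log (polyH Q) := (Real.le_log_iff_exp_le hQ0).mpr hHQ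
  have heval : Real.log |pev ζ (P * Q)| =
      Real.log |pev ζ P| + (-1 + δ) * Real.log (polyH Q) := by
    rw [← Real.log_rpow hQ0, ← hQδ, ← Real.log_mul (abs_ne_zero.mpr hP) (abs_ne_zero.mpr hQ),
      ← abs_mul]
    simp [pev]
  rw [heval]
  generalize Real.log |pev ζ P| = p at *
  generalize Real.log (polyH P) = a at *
  generalize Real.log (polyH Q) = h at *
  obtain ⟨E, hEdef⟩ : ∃ E, Real.log (polyH (P * Q)) = a + h + E :=
    ⟨Real.log (polyH (P * Q)) - a - h, by ring⟩
  rw [hEdef] at hE ⊢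
  have hh0 : 0 < h := by linarith
  have hEc : |E| ≤ c := by
    convert hE using 2
    ring
  have hEh : |E| ≤ c * C₀ * |δ| * h := by
    rw [div_le_iff₀ hh0] at hQC
    nlinarith
  obtain ⟨hδ₁, hδ₂⟩ := abs_le.mp hδ
  obtain ⟨hE₁, hE₂⟩ := abs_le.mp hEc
  have hD : (3 / 4) * h ≤ 3 / 4 * (a + h + E - (p + (-1 + δ) * h)) - 3 / 4 * (a - p) := by
    nlinarith
  have hD0 := (mul_pos (by norm_num : (0 : ℝ) < 3 / 4) hh0).trans_le hD
  refine ⟨(sub_pos.mp hD0).ne', ?_⟩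
  rw [div_sub' hD0.ne', abs_div, abs_of_pos hD0, div_le_iff₀ hD0]
  calc _ = |δ * h / 2 + E / 2| := by congr 1; ring
    _ ≤ |δ * h / 2| + |E / 2| := abs_add_le _ _
    _ = |δ| * h / 2 + |E| / 2 := by simp [abs_div, abs_mul, abs_of_pos hh0]
    _ ≤ (1 + c * C₀) * |δ| * (3 / 4 * h) := by
        have h₁ : 0 ≤ |δ| * h := by positivity
        have h₂ : 0 ≤ c * C₀ * |δ| * h := by positivity
        linarith
    _ ≤ _ := by gcongr
end
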